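/- arXiv:2307.03446 — 6 statements merged into one kernel-verified Lean document; each statement's English description precedes it below -/
import Mathlib

section
/- Let Φ be a CNF formula over Fin d each of whose clauses contains at most one negated literal, i.e. at most one literal of the form (i, false) (a Dual-Horn SAT formula). Then for every natural number p ≥ 1, the induced cubical complex N(disc(Φ)) is not homotopy equivalent to the p-dimensional unit sphere Metric.sphere (0 : EuclideanSpace ℝ (Fin (p+1))) 1. -/
/-- The discrete solution space of a CNF formula. -/
def cnfDisc {V : Type*} (Φ : Finset (Finset (V × Bool))) : Set (V → Bool) :=
  {x | ∀ C ∈ Φ, ∃ l ∈ C, x l.1 = l.2}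

/-- The induced cubical complex of a set `X` of Boolean vertices of the unit cube. -/
def inducedCubicalComplex {V : Type*} (X : Set (V → Bool)) : Set (V → ℝ) :=
  {p | (∀ i, 0 ≤ p i ∧ p i ≤ 1) ∧
    ∀ v : V → Bool, (∀ i, (p i = 0 → v i = false) ∧ (p i = 1 → v i = true)) → v ∈ X}

open MeasureTheory Metric Set

section Analysis

variable {E : Type*} [NormedAddCommGroup E]

theorem exists_polynomial_eval_eq_det_one_add_smul [NormedSpace ℝ E] [FiniteDimensional ℝ E]
    (A : E →L[ℝ] E) :
    ∃ P : Polynomial ℝ, P.natDegree ≤ Module.finrank ℝ E ∧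
      ∀ t : ℝ, P.eval t = (ContinuousLinearMap.id ℝ E + t • A).det := by
  classical
  let b := Module.finBasis ℝ E
  let M := LinearMap.toMatrix b b (A : E →ₗ[ℝ] E)
  refine ⟨((Polynomial.X : Polynomial ℝ) • M.map Polynomial.C +
    (1 : Matrix _ _ ℝ).map Polynomial.C).det, ?_, fun t => ?_⟩
  · simpa using Polynomial.natDegree_det_X_add_C_le M 1
  · rw [ContinuousLinearMap.det, ← LinearMap.det_toMatrix b, ← Polynomial.coe_evalRingHom,
      RingHom.map_det]
    congr 1
    ext i j
    simp [M, Matrix.one_apply, LinearMap.toMatrix_apply, Finsupp.single_apply, eq_comm, add_comm]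
    split_ifs <;> simp [mul_comm]

theorem exists_polynomial_eval_eq_norm_pow_mul_det [InnerProductSpace ℝ E] [FiniteDimensional ℝ E]
    (c : ℝ) (k : ℕ) (x v : E) (A : E →L[ℝ] E) :
    ∃ P : Polynomial ℝ, P.natDegree ≤ 2 * k + Module.finrank ℝ E ∧
      ∀ t : ℝ, P.eval t =
        (1 - c * ‖x + t • v‖ ^ 2) ^ k * (ContinuousLinearMap.id ℝ E + t • A).det := by
  obtain ⟨P, hP, hPe⟩ := exists_polynomial_eval_eq_det_one_add_smul A
  let S : Polynomial ℝ := Polynomial.C (-c * ‖v‖ ^ 2) * Polynomial.X ^ 2 +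
    Polynomial.C (-c * (2 * inner ℝ x v)) * Polynomial.X + Polynomial.C (1 - c * ‖x‖ ^ 2)
  refine ⟨S ^ k * P, ?_, fun t => ?_⟩
  · refine Polynomial.natDegree_mul_le.trans (add_le_add ?_ hP)
    refine Polynomial.natDegree_pow_le.trans ?_
    rw [mul_comm]
    exact Nat.mul_le_mul_right _ Polynomial.natDegree_quadratic_le
  · rw [Polynomial.eval_mul, Polynomial.eval_pow, hPe, norm_add_sq_real, inner_smul_right,
      norm_smul, Real.norm_eq_abs, mul_pow, sq_abs]
    congr 2
    simp [S]
    ring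

theorem Polynomial.exists_interpolation_weights (N : ℕ) {δ : ℝ} (hδ : 0 < δ) :
    ∃ (s w : ℕ → ℝ), (∀ i, 0 ≤ s i ∧ s i ≤ δ) ∧ ∑ i ∈ Finset.range (N + 1), w i = 1 ∧
      ∀ P : Polynomial ℝ, P.natDegree ≤ N →
        P.eval 1 = ∑ i ∈ Finset.range (N + 1), w i * P.eval (s i) := by
  let s : ℕ → ℝ := fun i => δ / (i + 1)
  have hs : Set.InjOn s (Finset.range (N + 1) : Finset ℕ) := by
    intro i _ j _ h
    have hi : (0 : ℝ) < i + 1 := by positivity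
    have hj : (0 : ℝ) < j + 1 := by positivity
    simp only [s] at h
    field_simp at h
    exact_mod_cast (add_right_cancel h).symm
  have key : ∀ P : Polynomial ℝ, P.natDegree ≤ N →
        P.eval 1 = ∑ i ∈ Finset.range (N + 1),
          (Lagrange.basis (Finset.range (N + 1)) s i).eval 1 * P.eval (s i) := by
    intro P hP
    have hd : P.degree < (Finset.range (N + 1)).card := by
      rw [Finset.card_range]
      exact (Polynomial.degree_le_of_natDegree_le hP).trans_lt
        (by exact_mod_cast Nat.lt_succ_self N)
    conv_lhs => rw [Lagrange.eq_interpolate hs hd]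
    simp [Lagrange.interpolate_apply, Polynomial.eval_finsetSum, mul_comm]
  refine ⟨s, fun i => (Lagrange.basis (Finset.range (N + 1)) s i).eval 1, fun i => ?_, ?_, key⟩
  · have hi : (0 : ℝ) < i + 1 := by positivity
    refine ⟨by positivity, ?_⟩
    exact div_le_self hδ.le (by linarith [Nat.cast_nonneg (α := ℝ) i])
  · simpa using (key 1 (by simp)).symm

variable [NormedSpace ℝ E]

theorem image_closedBall_add_smul_eq {g : E → E} {R : ℝ}
    (hsupp : Function.support g ⊆ closedBall 0 R) {t : ℝ}
    (ht : Function.Bijective fun x => x + t • g x) :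
    (fun x => x + t • g x) '' closedBall 0 R = closedBall 0 R := by
  have h : ∀ x ∉ closedBall (0 : E) R, x + t • g x = x := fun x hx => by
    rw [Function.notMem_support.1 fun h => hx (hsupp h), smul_zero, add_zero]
  rw [← compl_inj_iff, ← image_compl_eq ht]
  exact (image_congr h).trans (image_id' _)

variable [FiniteDimensional ℝ E]

theorem bijective_add_smul_of_lipschitzWith {g : E → E} {K : NNReal} (hg : LipschitzWith K g)
    {t : ℝ} (ht : 0 ≤ t) (htK : t * K < 1) : Function.Bijective fun x => x + t • g x := by
  have hl : ∀ x y, ‖t • g x - t • g y‖ ≤ t * K * ‖x - y‖ := by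
    intro x y
    rw [← smul_sub, norm_smul, Real.norm_of_nonneg ht, mul_assoc]
    exact mul_le_mul_of_nonneg_left (hg.norm_sub_le x y) ht
  constructor
  · intro x y hxy
    have h1 : x - y = -(t • g x - t • g y) := by
      rw [← sub_eq_zero] at hxy ⊢
      rw [← hxy]; dsimp only; abel
    have h2 := hl x y
    rw [← norm_neg, ← h1] at h2
    by_contra hne
    have := norm_pos_iff.2 (sub_ne_zero.2 hne)
    nlinarith
  · intro y
    have hc : ContractingWith (t * K).toNNReal fun x => y - t • g x := by
      refine ⟨by rw [← NNReal.coe_lt_coe, Real.coe_toNNReal _ (by positivity)]; exact_mod_cast htK,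
        LipschitzWith.of_dist_le_mul fun a b => ?_⟩
      rw [dist_eq_norm, dist_eq_norm, Real.coe_toNNReal _ (by positivity), norm_sub_rev]
      rw [show y - t • g b - (y - t • g a) = t • g a - t • g b by abel]
      exact hl a b
    have : CompleteSpace E := FiniteDimensional.complete ℝ E
    refine ⟨hc.fixedPoint, ?_⟩
    have := hc.fixedPoint_isFixedPt
    dsimp only
    nth_rewrite 1 [← this.eq]
    abel

theorem det_one_add_smul_pos {A : E →L[ℝ] E} {K : ℝ} (hA : ‖A‖ ≤ K)
    {t : ℝ} (ht : 0 ≤ t) (htK : t * K < 1) : 0 < (ContinuousLinearMap.id ℝ E + t • A).det := by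
  have hne : ∀ s ∈ Icc 0 t, (ContinuousLinearMap.id ℝ E + s • A).det ≠ 0 := by
    intro s hs h
    obtain ⟨v, hv, hv0⟩ := Submodule.exists_mem_ne_zero_of_ne_bot
      (LinearMap.bot_lt_ker_of_det_eq_zero h).ne'
    rw [LinearMap.mem_ker] at hv
    have hv' : v = -(s • A v) := eq_neg_of_add_eq_zero_left (by simpa using hv)
    have h1 : ‖v‖ = s * ‖A v‖ := by
      conv_lhs => rw [hv', norm_neg, norm_smul, Real.norm_of_nonneg hs.1]
    have h2 := A.le_of_opNorm_le hA v
    have h3 := norm_pos_iff.2 hv0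
    have hK : 0 ≤ K := (norm_nonneg A).trans hA
    have h4 : s * ‖A v‖ ≤ s * (K * ‖v‖) := mul_le_mul_of_nonneg_left h2 hs.1
    have h5 : s * K ≤ t * K := mul_le_mul_of_nonneg_right hs.2 hK
    nlinarith
  have hcont : Continuous fun s : ℝ => (ContinuousLinearMap.id ℝ E + s • A).det :=
    ContinuousLinearMap.continuous_det.comp (by fun_prop)
  by_contra! hle
  obtain ⟨s, hs, hs0⟩ := intermediate_value_Icc' ht hcont.continuousOn
    (show (0 : ℝ) ∈ _ from ⟨hle, by simp [ContinuousLinearMap.det]⟩)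
  exact hne s hs hs0

theorem setIntegral_comp_add_smul_mul_det [MeasurableSpace E] [BorelSpace E]
    {g : E → E} {R : ℝ} (μ : Measure E) [μ.IsAddHaarMeasure]
    (hg : ContDiff ℝ 1 g) {K : NNReal}
    (hK : LipschitzWith K g) (hsupp : Function.support g ⊆ closedBall 0 R) (ψ : E → ℝ)
    {t : ℝ} (ht : 0 ≤ t) (htK : t * K < 1) :
    ∫ x in closedBall 0 R, ψ (x + t • g x) * (ContinuousLinearMap.id ℝ E + t • fderiv ℝ g x).det ∂μ
      = ∫ x in closedBall 0 R, ψ x ∂μ := by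
  have hbij := bijective_add_smul_of_lipschitzWith hK ht htK
  conv_rhs => rw [← image_closedBall_add_smul_eq hsupp hbij]
  have hd : ∀ x, HasFDerivAt (fun x => x + t • g x)
      (ContinuousLinearMap.id ℝ E + t • fderiv ℝ g x) x := fun x =>
    (hasFDerivAt_id x).add ((hg.differentiable one_ne_zero x).hasFDerivAt.const_smul t)
  rw [integral_image_eq_integral_abs_det_fderiv_smul μ measurableSet_closedBall
    (fun x _ => (hd x).hasFDerivWithinAt) hbij.injective.injOn]
  congr 1
  ext x
  rw [abs_of_pos (det_one_add_smul_pos (norm_fderiv_le_of_lipschitz ℝ hK) ht htK), smul_eq_mul,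
    mul_comm]

end Analysis

section Inner

variable {E : Type*} [NormedAddCommGroup E] [InnerProductSpace ℝ E] [FiniteDimensional ℝ E]
  [MeasurableSpace E] [BorelSpace E] {g : E → E} {R : ℝ}

theorem setIntegral_norm_pow_mul_det (μ : Measure E) [μ.IsAddHaarMeasure] (hg : ContDiff ℝ 1 g)
    (hsupp : Function.support g ⊆ closedBall 0 R) (c : ℝ) (k : ℕ) :
    ∫ x in closedBall 0 R, (1 - c * ‖x + g x‖ ^ 2) ^ k *
        (ContinuousLinearMap.id ℝ E + fderiv ℝ g x).det ∂μ
      = ∫ x in closedBall 0 R, (1 - c * ‖x‖ ^ 2) ^ k ∂μ := by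
  have hcs : HasCompactSupport g :=
    HasCompactSupport.of_support_subset_isCompact (isCompact_closedBall 0 R) hsupp
  obtain ⟨K, hK⟩ := hg.lipschitzWith_of_hasCompactSupport hcs one_ne_zero
  obtain ⟨s, w, hs, hw, hP⟩ := Polynomial.exists_interpolation_weights
    (2 * k + Module.finrank ℝ E) (δ := 1 / (K + 1)) (by positivity)
  have hpt : ∀ x, (1 - c * ‖x + g x‖ ^ 2) ^ k *
      (ContinuousLinearMap.id ℝ E + fderiv ℝ g x).det =
      ∑ i ∈ Finset.range (2 * k + Module.finrank ℝ E + 1), w i *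
        ((1 - c * ‖x + s i • g x‖ ^ 2) ^ k *
          (ContinuousLinearMap.id ℝ E + s i • fderiv ℝ g x).det) := by
    intro x
    obtain ⟨P, hPd, hPe⟩ := exists_polynomial_eval_eq_norm_pow_mul_det c k x (g x) (fderiv ℝ g x)
    simpa [hPe] using hP P hPd
  have hcd := hg.continuous_fderiv one_ne_zero
  have hcg := hg.continuous
  simp_rw [hpt]
  rw [integral_finsetSum]
  · calc _ = ∑ i ∈ Finset.range (2 * k + Module.finrank ℝ E + 1),
          w i * ∫ x in closedBall 0 R, (1 - c * ‖x‖ ^ 2) ^ k ∂μ := by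
          refine Finset.sum_congr rfl fun i _ => ?_
          rw [integral_const_mul]
          congr 1
          refine setIntegral_comp_add_smul_mul_det μ hg hK hsupp
            (fun x => (1 - c * ‖x‖ ^ 2) ^ k) (hs i).1 ?_
          have h1 := mul_le_mul_of_nonneg_right (hs i).2 K.coe_nonneg
          refine h1.trans_lt ?_
          rw [one_div, inv_mul_eq_div, div_lt_one (by positivity)]
          linarith
      _ = _ := by rw [← Finset.sum_mul, hw, one_mul]
  · intro i _
    refine ContinuousOn.integrableOn_compact (isCompact_closedBall 0 R) (Continuous.continuousOn ?_)
    have := ContinuousLinearMap.continuous_det.comp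
      (f := fun x => ContinuousLinearMap.id ℝ E + s i • fderiv ℝ g x) (by fun_prop)
    simp only [Function.comp_def] at this
    fun_prop

theorem exists_norm_add_lt_of_contDiff (hg : ContDiff ℝ 1 g)
    (hsupp : Function.support g ⊆ closedBall 0 R) {ε : ℝ} (hε : 0 < ε) : ∃ x, ‖x + g x‖ < ε := by
  by_contra! hlow
  wlog hR : ε ≤ R generalizing R
  · exact this (R := ε) (hsupp.trans (closedBall_subset_closedBall (not_le.1 hR).le)) le_rfl
  have hcg := hg.continuous
  have hcd : Continuous fun x => (ContinuousLinearMap.id ℝ E + fderiv ℝ g x).det :=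
    ContinuousLinearMap.continuous_det.comp
      (continuous_const.add (hg.continuous_fderiv one_ne_zero))
  obtain ⟨M, hM⟩ := (isCompact_closedBall (0 : E) R).exists_bound_of_continuousOn
    (f := fun x => x + g x) (by fun_prop)
  have hR0 : 0 < R := hε.trans_le hR
  set N := max M R
  have hN0 : 0 < N := hR0.trans_le (le_max_right _ _)
  set c := 1 / N ^ 2 with hc
  have hc0 : 0 < c := by positivity
  have hcN : ∀ r, 0 ≤ r → r ≤ N → c * r ^ 2 ≤ 1 := fun r hr hrN => by
    rw [hc, one_div, inv_mul_eq_div, div_le_one (by positivity)]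
    exact pow_le_pow_left₀ hr hrN 2
  set a := 1 - c * ε ^ 2 with ha
  set b := 1 - c * (ε / 2) ^ 2 with hb
  have ha0 : 0 ≤ a := sub_nonneg.2 (hcN ε hε.le (hR.trans (le_max_right _ _)))
  have hab : a < b := by
    have : 0 < c * ε ^ 2 := by positivity
    rw [ha, hb]; nlinarith
  have hb0 : 0 < b := ha0.trans_lt hab
  let μ : Measure E := Measure.addHaar
  set D := ∫ x in closedBall 0 R, |(ContinuousLinearMap.id ℝ E + fderiv ℝ g x).det| ∂μ
  have hD0 : 0 ≤ D := integral_nonneg fun x => abs_nonneg _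
  set V := μ.real (closedBall 0 (ε / 2))
  have hV0 : 0 < V := ENNReal.toReal_pos (measure_closedBall_pos μ _ (by positivity)).ne'
    measure_closedBall_lt_top.ne
  have hint : ∀ {f : E → ℝ}, Continuous f → IntegrableOn f (closedBall 0 R) μ := fun hf =>
    ContinuousOn.integrableOn_compact (isCompact_closedBall 0 R) hf.continuousOn
  have key : ∀ k : ℕ, b ^ k * V ≤ a ^ k * D := by
    intro k
    calc b ^ k * V = ∫ x in closedBall 0 (ε / 2), b ^ k ∂μ := by
          rw [setIntegral_const, smul_eq_mul, mul_comm]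
      _ ≤ ∫ x in closedBall 0 (ε / 2), (1 - c * ‖x‖ ^ 2) ^ k ∂μ := by
          refine setIntegral_mono_on (integrableOn_const measure_closedBall_lt_top.ne)
            ((hint (by fun_prop)).mono_set (closedBall_subset_closedBall (by linarith)))
            measurableSet_closedBall fun x hx => ?_
          have hx' : ‖x‖ ≤ ε / 2 := mem_closedBall_zero_iff.1 hx
          refine pow_le_pow_left₀ hb0.le ?_ k
          rw [hb]
          gcongr
      _ ≤ ∫ x in closedBall 0 R, (1 - c * ‖x‖ ^ 2) ^ k ∂μ := by
          refine setIntegral_mono_set (hint (by fun_prop)) ?_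
            (closedBall_subset_closedBall (by linarith)).eventuallyLE
          refine (ae_restrict_iff' measurableSet_closedBall).2 (ae_of_all _ fun x hx => ?_)
          exact pow_nonneg (sub_nonneg.2 (hcN _ (norm_nonneg x)
            ((mem_closedBall_zero_iff.1 hx).trans (le_max_right _ _)))) k
      _ = ∫ x in closedBall 0 R, (1 - c * ‖x + g x‖ ^ 2) ^ k *
          (ContinuousLinearMap.id ℝ E + fderiv ℝ g x).det ∂μ :=
          (setIntegral_norm_pow_mul_det μ hg hsupp c k).symm
      _ ≤ ∫ x in closedBall 0 R, a ^ k *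
          |(ContinuousLinearMap.id ℝ E + fderiv ℝ g x).det| ∂μ := by
          refine setIntegral_mono_on (hint (by fun_prop)) (hint (by fun_prop))
            measurableSet_closedBall fun x hx => ?_
          have h0 : 0 ≤ 1 - c * ‖x + g x‖ ^ 2 :=
            sub_nonneg.2 (hcN _ (norm_nonneg _) ((hM x hx).trans (le_max_left _ _)))
          have h1 := hlow x
          calc _ ≤ (1 - c * ‖x + g x‖ ^ 2) ^ k *
                |(ContinuousLinearMap.id ℝ E + fderiv ℝ g x).det| :=
                mul_le_mul_of_nonneg_left (le_abs_self _) (pow_nonneg h0 k)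
            _ ≤ _ := by
                refine mul_le_mul_of_nonneg_right (pow_le_pow_left₀ h0 ?_ k) (abs_nonneg _)
                rw [ha]
                gcongr
      _ = a ^ k * D := integral_const_mul _ _
  obtain ⟨k, hk⟩ := exists_pow_lt_of_lt_one (show 0 < V / (D + 1) by positivity)
    ((div_lt_one hb0).2 hab)
  rw [div_pow, div_lt_div_iff₀ (by positivity) (by positivity)] at hk
  have := key k
  have hak : 0 ≤ a ^ k := pow_nonneg ha0 k
  nlinarith

end Inner

section Sphere

open Classical in
theorem exists_normalize_continuousAt {E : Type*} [NormedAddCommGroup E] [NormedSpace ℝ E]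
    (y : sphere (0 : E) 1) :
    ∃ ν : E → sphere (0 : E) 1, (∀ x, x ≠ 0 → ContinuousAt ν x ∧ ‖x‖ • (ν x : E) = x) := by
  let ν : E → sphere (0 : E) 1 := fun x =>
    if h : x = 0 then y else ⟨‖x‖⁻¹ • x, by simp [norm_smul, h]⟩
  have hν : ∀ x, x ≠ 0 → (ν x : E) = ‖x‖⁻¹ • x := fun x hx => by simp [ν, hx]
  refine ⟨ν, fun x hx => ⟨?_, ?_⟩⟩
  · rw [Topology.IsInducing.subtypeVal.continuousAt_iff]
    have h : ContinuousAt (fun x : E => ‖x‖⁻¹ • x) x :=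
      (continuousAt_id.norm.inv₀ (norm_ne_zero_iff.2 hx)).smul continuousAt_id
    refine h.congr ?_
    filter_upwards [isOpen_ne.mem_nhds hx] with z hz
    exact (hν z hz).symm
  · rw [hν x hx, smul_inv_smul₀ (norm_ne_zero_iff.2 hx)]

theorem not_contractibleSpace_sphere {E : Type*} [NormedAddCommGroup E] [InnerProductSpace ℝ E]
    [FiniteDimensional ℝ E] : ¬ ContractibleSpace (sphere (0 : E) 1) := by
  intro hcontr
  obtain ⟨y, ⟨H⟩⟩ := id_nullhomotopic (sphere (0 : E) 1)
  obtain ⟨ν, hν⟩ := exists_normalize_continuousAt y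
  let τ : E → unitInterval := fun x => projIcc 0 1 zero_le_one (2 - 2 * ‖x‖)
  let r : E → E := fun x => max 1 ‖x‖ • (H (τ x, ν x) : E)
  have hτ : Continuous τ := continuous_projIcc.comp (by fun_prop)
  have hr : Continuous r := by
    rw [continuous_iff_continuousAt]
    intro x
    rcases eq_or_ne x 0 with rfl | hx
    · have hy : (fun _ => (y : E)) =ᶠ[nhds 0] r := by
        filter_upwards [ball_mem_nhds (0 : E) (show (0 : ℝ) < 1 / 2 by norm_num)] with z hz
        have hz' : ‖z‖ < 1 / 2 := mem_ball_zero_iff.1 hz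
        have h1 : τ z = 1 := projIcc_of_right_le _ (by linarith)
        simp [r, h1, max_eq_left (show ‖z‖ ≤ 1 by linarith)]
      exact continuousAt_const.congr hy
    · have h1 : ContinuousAt (fun x => max 1 ‖x‖) x := by fun_prop
      exact h1.smul (continuous_subtype_val.continuousAt.comp
        (H.continuous.continuousAt.comp (hτ.continuousAt.prodMk (hν x hx).1)))
  have hr_out : ∀ x, 1 ≤ ‖x‖ → r x = x := fun x hx => by
    have h1 : τ x = 0 := projIcc_of_le_left _ (by linarith)
    simp [r, h1, max_eq_right hx, (hν x (norm_pos_iff.1 (by linarith))).2]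
  have hr_norm : ∀ x, 1 ≤ ‖r x‖ := fun x => by
    simp [r, norm_smul, abs_of_pos (lt_max_of_lt_left zero_lt_one)]
  obtain ⟨g, hg, hgr, hgs⟩ := Continuous.exists_contDiff_approx (f := fun x => r x - x) 1
    (by fun_prop) (continuous_const (y := (1 / 2 : ℝ))) (fun _ => by norm_num)
  have hsupp : Function.support g ⊆ closedBall 0 1 := fun x hx => by
    by_contra hx'
    rw [mem_closedBall_zero_iff, not_le] at hx'
    exact hgs hx (sub_eq_zero.2 (hr_out x hx'.le))
  borelize E
  obtain ⟨x, hx⟩ := exists_norm_add_lt_of_contDiff (by exact_mod_cast hg) hsupp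
    (show (0 : ℝ) < 1 / 2 by norm_num)
  have h1 := hgr x
  rw [dist_eq_norm] at h1
  have h2 : r x = (x + g x) - (g x - (r x - x)) := by abel
  have h3 := norm_sub_le (x + g x) (g x - (r x - x))
  rw [← h2] at h3
  linarith [hr_norm x]

end Sphere

section PathConnected

theorem ContinuousMap.HomotopyEquiv.pathConnectedSpace {X Y : Type*} [TopologicalSpace X]
    [TopologicalSpace Y] (e : ContinuousMap.HomotopyEquiv X Y) [PathConnectedSpace Y] :
    PathConnectedSpace X := by
  obtain ⟨H⟩ := e.left_inv
  have h : ∀ x, Joined (e.invFun (e.toFun x)) x := fun x => ⟨H.evalAt x⟩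
  refine ⟨(PathConnectedSpace.nonempty (X := Y)).map e.invFun, fun a b => ?_⟩
  exact (h a).symm.trans
    (((PathConnectedSpace.joined (e.toFun a) (e.toFun b)).map e.invFun.continuous).trans (h b))

end PathConnected

section CubicalComplex

variable {V : Type*} {X : Set (V → Bool)}

/-- The vertex `v` lies in the smallest face of the unit cube containing `p`. -/
def IsFaceVertex (p : V → ℝ) (v : V → Bool) : Prop :=
  ∀ i, (p i = 0 → v i = false) ∧ (p i = 1 → v i = true)

theorem inducedCubicalComplex_mono {X Y : Set (V → Bool)} (h : X ⊆ Y) :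
    inducedCubicalComplex X ⊆ inducedCubicalComplex Y :=
  fun _ hp => ⟨hp.1, fun v hv => h (hp.2 v hv)⟩

theorem mem_inducedCubicalComplex_diff_singleton {p : V → ℝ} {v : V → Bool} :
    p ∈ inducedCubicalComplex (X \ {v}) ↔ p ∈ inducedCubicalComplex X ∧ ¬ IsFaceVertex p v := by
  constructor
  · exact fun hp => ⟨inducedCubicalComplex_mono sdiff_subset hp, fun hv => (hp.2 v hv).2 rfl⟩
  · rintro ⟨hp, hv⟩
    exact ⟨hp.1, fun w hw => ⟨hp.2 w hw, fun h => hv (h ▸ hw)⟩⟩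

theorem nonempty_of_nonempty_inducedCubicalComplex (h : (inducedCubicalComplex X).Nonempty) :
    X.Nonempty := by
  classical
  obtain ⟨p, hp⟩ := h
  refine ⟨fun i => decide (p i = 1), hp.2 _ fun i => ⟨fun h => ?_, fun h => ?_⟩⟩ <;> simp [h]

theorem isOpen_setOf_isFaceVertex [Finite V] (v : V → Bool) : IsOpen {p | IsFaceVertex p v} := by
  have : {p | IsFaceVertex p v} = ⋂ i, {p : V → ℝ | p i ≠ if v i then 0 else 1} := by
    ext p
    simp only [IsFaceVertex, mem_ofPred_eq, mem_iInter]
    refine forall_congr' fun i => ?_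
    cases v i <;> simp
  rw [this]
  exact isOpen_iInter_of_finite fun i => isOpen_ne.preimage (continuous_apply i)

theorem SupClosed.diff_singleton_of_minimal (hX : SupClosed X) {v : V → Bool}
    (hv : Minimal (· ∈ X) v) : SupClosed (X \ {v}) := by
  rintro a ⟨ha, hav⟩ b ⟨hb, -⟩
  refine ⟨hX ha hb, fun h => hav ?_⟩
  exact hv.eq_of_le ha ((le_sup_left (b := b)).trans_eq h)

section facetDist

variable [Fintype V] [Nonempty V]

/-- The distance from `p` to the facets of the unit cube that do not contain `v`. -/
noncomputable def facetDist (v : V → Bool) (p : V → ℝ) : ℝ :=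
  Finset.univ.inf' Finset.univ_nonempty fun i => if v i then p i else 1 - p i

theorem continuous_facetDist (v : V → Bool) : Continuous (facetDist v) := by
  refine Continuous.finset_inf'_apply _ fun i _ => ?_
  split_ifs <;> fun_prop

theorem facetDist_eq_zero {v : V → Bool} {p : V → ℝ} (hp : ∀ i, 0 ≤ p i ∧ p i ≤ 1)
    (hpv : ¬ IsFaceVertex p v) : facetDist v p = 0 := by
  refine le_antisymm ?_ (Finset.le_inf' _ _ fun i _ => ?_)
  · obtain ⟨i, hi⟩ := not_forall.1 hpv
    refine (Finset.inf'_le _ (Finset.mem_univ i)).trans ?_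
    cases h : v i <;> simp_all
  · split_ifs
    · exact (hp i).1
    · linarith [(hp i).2]

theorem facetDist_le {v : V → Bool} (p : V → ℝ) {i : V} (hi : v i = false) :
    facetDist v p ≤ 1 - p i := by
  refine (Finset.inf'_le _ (Finset.mem_univ i)).trans_eq ?_
  simp [hi]

theorem facetDist_nonneg {v : V → Bool} {p : V → ℝ} (hp : ∀ i, 0 ≤ p i ∧ p i ≤ 1) :
    0 ≤ facetDist v p := by
  refine Finset.le_inf' _ _ fun i _ => ?_
  split_ifs
  · exact (hp i).1
  · linarith [(hp i).2]

end facetDist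

variable [DecidableEq V]

/-- The directions of the edges going up from the vertex `v` inside `X`. -/
def upDirections (X : Set (V → Bool)) (v : V → Bool) : Set V :=
  {i | v i = false ∧ Function.update v i true ∈ X}

/-- The face of the unit cube spanned by the edges going up from `v` inside `X`. -/
def upFace (X : Set (V → Bool)) (v : V → Bool) : Set (V → ℝ) :=
  {p | ∀ i, 0 ≤ p i ∧ p i ≤ 1 ∧ (v i = true → p i = 1) ∧
    (v i = false → i ∉ upDirections X v → p i = 0)}

theorem mem_of_forall_mem_upDirections [Finite V] (hX : SupClosed X) {v : V → Bool} (hv : v ∈ X)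
    {w : V → Bool} (hvw : v ≤ w) (hw : ∀ i, w i = true → v i = false → i ∈ upDirections X v) :
    w ∈ X := by
  have := Fintype.ofFinite V
  have key : ∀ S : Finset V, (∀ i ∈ S, i ∈ upDirections X v) →
      (fun i => v i || decide (i ∈ S)) ∈ X := by
    intro S
    induction S using Finset.induction_on with
    | empty => intro _; simpa using hv
    | insert j S hj ih =>
      intro hS
      have h1 := hX (ih fun i hi => hS i (Finset.mem_insert_of_mem hi))
        (hS j (Finset.mem_insert_self j S)).2
      convert h1 using 1
      ext i
      rcases eq_or_ne i j with rfl | hij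
      · simp
      · cases h : v i <;> simp [hij, h]
  convert key (Finset.univ.filter fun i => w i = true ∧ v i = false) (by simpa using hw) using 1
  ext i
  have h1 : v i = true → w i = true := hvw i
  cases hvi : v i <;> cases hwi : w i <;> simp_all

theorem upFace_subset [Finite V] (hX : SupClosed X) {v : V → Bool} (hv : v ∈ X) :
    upFace X v ⊆ inducedCubicalComplex X := by
  intro p hp
  refine ⟨fun i => ⟨(hp i).1, (hp i).2.1⟩, fun w hw => ?_⟩
  refine mem_of_forall_mem_upDirections hX hv (fun i => ?_) fun i hwi hvi => ?_
  · cases hvi : v i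
    · simp
    · simp [(hw i).2 ((hp i).2.2.1 hvi)]
  · by_contra hi
    simp [(hw i).1 ((hp i).2.2.2 hvi hi)] at hwi

theorem mem_upFace_of_isFaceVertex {v : V → Bool} (hv : Minimal (· ∈ X) v) {p : V → ℝ}
    (hp : p ∈ inducedCubicalComplex X) (hpv : IsFaceVertex p v) : p ∈ upFace X v := by
  have hflip : ∀ i b, p i ≠ 0 → p i ≠ 1 → Function.update v i b ∈ X := fun i b h0 h1 =>
    hp.2 _ fun j => by
      rcases eq_or_ne j i with rfl | hj
      · simp [h0, h1]
      · simpa [hj] using hpv j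
  refine fun i => ⟨(hp.1 i).1, (hp.1 i).2, fun hvi => ?_, fun hvi hi => ?_⟩
  · by_contra h1
    have h0 : p i ≠ 0 := fun h => by simp [(hpv i).1 h] at hvi
    have hle : Function.update v i false ≤ v := update_le_iff.2 ⟨by simp, fun _ _ => le_rfl⟩
    have := congrFun (hv.eq_of_le (hflip i false h0 h1) hle) i
    simp [hvi] at this
  · by_contra h0
    have h1 : p i ≠ 1 := fun h => by simp [(hpv i).2 h] at hvi
    exact hi ⟨hvi, hflip i true h0 h1⟩

theorem subsingleton_of_upDirections_eq_empty [Finite V] {v : V → Bool}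
    [PreconnectedSpace (inducedCubicalComplex X)] (hX : SupClosed X)
    (hv : Minimal (· ∈ X) v) (hJ : upDirections X v = ∅) :
    Subsingleton (inducedCubicalComplex X) := by
  let q : V → ℝ := fun i => if v i then 1 else 0
  have hq : q ∈ inducedCubicalComplex X := upFace_subset hX hv.prop fun i => by
    cases h : v i <;> simp [q, h]
  have heq : {p : inducedCubicalComplex X | IsFaceVertex p.1 v} = {⟨q, hq⟩} := by
    ext p
    constructor
    · intro hp
      have := mem_upFace_of_isFaceVertex hv p.2 hp
      ext i
      cases h : v i
      · simpa [q, h] using (this i).2.2.2 h (by simp [hJ])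
      · simpa [q, h] using (this i).2.2.1 h
    · rintro rfl i
      cases h : v i <;> simp [q, h]
  have hclopen : IsClopen ({⟨q, hq⟩} : Set (inducedCubicalComplex X)) :=
    ⟨isClosed_singleton, heq ▸ (isOpen_setOf_isFaceVertex v).preimage continuous_subtype_val⟩
  exact subsingleton_of_univ_subsingleton
    (hclopen.eq_univ (singleton_nonempty _) ▸ subsingleton_singleton)

section Push

variable [Fintype V] [Nonempty V]

theorem exists_facetDist_eq {v : V → Bool} {p : V → ℝ} (hp : p ∈ upFace X v)
    (hJ : (upDirections X v).Nonempty) : ∃ i ∈ upDirections X v, facetDist v p = 1 - p i := by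
  obtain ⟨i, -, hi⟩ := Finset.exists_mem_eq_inf' Finset.univ_nonempty
    fun i => if v i then p i else 1 - p i
  by_cases hiJ : i ∈ upDirections X v
  · exact ⟨i, hiJ, by simpa [facetDist, hiJ.1] using hi⟩
  · obtain ⟨j, hj⟩ := hJ
    have h1 : facetDist v p = 1 := by
      refine hi.trans ?_
      cases h : v i
      · simp [(hp i).2.2.2 h hiJ]
      · simp [(hp i).2.2.1 h]
    refine ⟨j, hj, le_antisymm (facetDist_le p hj.1) ?_⟩
    linarith [(hp j).1]

/-- Pushing points of the star of `v` away from `v`, in all upward directions at equal speed. -/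
noncomputable def pushUp (X : Set (V → Bool)) (v : V → Bool) (s : ℝ) (p : V → ℝ) : V → ℝ :=
  p + (s * facetDist v p) • (upDirections X v).indicator 1

theorem continuous_pushUp (v : V → Bool) :
    Continuous fun z : ℝ × (V → ℝ) => pushUp X v z.1 z.2 := by
  have := continuous_facetDist v
  unfold pushUp
  fun_prop

theorem pushUp_eq_self {v : V → Bool} {p : V → ℝ} (hp : ∀ i, 0 ≤ p i ∧ p i ≤ 1)
    (hpv : ¬ IsFaceVertex p v) (s : ℝ) : pushUp X v s p = p := by
  simp [pushUp, facetDist_eq_zero hp hpv]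

theorem pushUp_mem_upFace {v : V → Bool} {p : V → ℝ} (hp : p ∈ upFace X v) {s : ℝ} (hs : 0 ≤ s)
    (hs1 : s ≤ 1) : pushUp X v s p ∈ upFace X v := by
  have hp01 : ∀ i, 0 ≤ p i ∧ p i ≤ 1 := fun i => ⟨(hp i).1, (hp i).2.1⟩
  intro i
  by_cases hi : i ∈ upDirections X v
  · have h0 := facetDist_nonneg (v := v) hp01
    have h1 := facetDist_le p hi.1
    have h2 := (hp i).1
    have h3 : s * facetDist v p ≤ facetDist v p := mul_le_of_le_one_left h0 hs1
    have h4 : 0 ≤ s * facetDist v p := mul_nonneg hs h0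
    simp only [pushUp, Pi.add_apply, Pi.smul_apply, indicator_of_mem hi, Pi.one_apply,
      smul_eq_mul, mul_one]
    exact ⟨by linarith, by linarith, by simp [hi.1], fun _ h => absurd hi h⟩
  · simpa [pushUp, hi] using hp i

theorem pushUp_mem {v : V → Bool} {p : V → ℝ} (hX : SupClosed X) (hv : Minimal (· ∈ X) v)
    (hp : p ∈ inducedCubicalComplex X) {s : ℝ} (hs : 0 ≤ s) (hs1 : s ≤ 1) :
    pushUp X v s p ∈ inducedCubicalComplex X := by
  by_cases hpv : IsFaceVertex p v
  · exact upFace_subset hX hv.prop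
      (pushUp_mem_upFace (mem_upFace_of_isFaceVertex hv hp hpv) hs hs1)
  · rwa [pushUp_eq_self hp.1 hpv]

theorem pushUp_one_mem {v : V → Bool} {p : V → ℝ} (hX : SupClosed X) (hv : Minimal (· ∈ X) v)
    (hJ : (upDirections X v).Nonempty) (hp : p ∈ inducedCubicalComplex X) :
    pushUp X v 1 p ∈ inducedCubicalComplex (X \ {v}) := by
  refine mem_inducedCubicalComplex_diff_singleton.2
    ⟨pushUp_mem hX hv hp zero_le_one le_rfl, fun h => ?_⟩
  by_cases hpv : IsFaceVertex p v
  · obtain ⟨i, hi, hd⟩ := exists_facetDist_eq (mem_upFace_of_isFaceVertex hv hp hpv) hJ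
    have := (h i).2 (by simp [pushUp, hi, hd])
    simp [hi.1] at this
  · rw [pushUp_eq_self hp.1 hpv] at h
    exact hpv h

end Push

theorem nonempty_homotopyEquiv_inducedCubicalComplex_diff_singleton [Finite V] {v : V → Bool}
    (hX : SupClosed X) (hv : Minimal (· ∈ X) v) (hJ : (upDirections X v).Nonempty) :
    Nonempty (ContinuousMap.HomotopyEquiv (inducedCubicalComplex X)
      (inducedCubicalComplex (X \ {v}))) := by
  have := Fintype.ofFinite V
  have : Nonempty V := ⟨hJ.some⟩
  have hcont := continuous_pushUp (X := X) v
  have hr : ∀ p : inducedCubicalComplex (X \ {v}), ∀ s, pushUp X v s p.1 = p.1 := fun p s =>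
    pushUp_eq_self p.2.1 (mem_inducedCubicalComplex_diff_singleton.1 p.2).2 s
  have hid : ∀ f : C(inducedCubicalComplex (X \ {v}), inducedCubicalComplex (X \ {v})),
      (∀ p, (f p).1 = p.1) → f.Homotopic (ContinuousMap.id _) := fun f hf =>
    (ContinuousMap.ext fun p => Subtype.ext (hf p) : f = ContinuousMap.id _) ▸ .refl f
  refine ⟨⟨⟨fun p => ⟨pushUp X v 1 p.1, pushUp_one_mem hX hv hJ p.2⟩, ?_⟩,
    ⟨inclusion (inducedCubicalComplex_mono sdiff_subset), continuous_inclusion _⟩,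
    ContinuousMap.Homotopic.symm
      ⟨⟨⟨fun z => ⟨pushUp X v z.1 z.2.1, pushUp_mem hX hv z.2.2 z.1.2.1 z.1.2.2⟩, ?_⟩, ?_, ?_⟩⟩, ?_⟩⟩
  · exact Continuous.subtype_mk (hcont.comp (by fun_prop : Continuous
      fun p : inducedCubicalComplex X => ((1 : ℝ), p.1))) _
  · exact Continuous.subtype_mk (hcont.comp (by fun_prop : Continuous
      fun z : unitInterval × inducedCubicalComplex X => ((z.1 : ℝ), z.2.1))) _
  · intro p
    ext i
    simp [pushUp]
  · intro p
    ext i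
    simp
  · exact hid _ fun p => hr p 1

end CubicalComplex

theorem contractibleSpace_inducedCubicalComplex {V : Type*} [Finite V] {X : Set (V → Bool)}
    (hX : SupClosed X) [PathConnectedSpace (inducedCubicalComplex X)] :
    ContractibleSpace (inducedCubicalComplex X) := by
  classical
  induction hn : X.ncard using Nat.strong_induction_on generalizing X with
  | _ n ih =>
    have hne : Nonempty (inducedCubicalComplex X) := PathConnectedSpace.nonempty
    obtain ⟨v, hv⟩ := (toFinite X).exists_minimal
      (nonempty_of_nonempty_inducedCubicalComplex (nonempty_coe_sort.1 hne))
    rcases (upDirections X v).eq_empty_or_nonempty with hJ | hJ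
    · have := subsingleton_of_upDirections_eq_empty hX hv hJ
      have := uniqueOfSubsingleton hne.some
      infer_instance
    · obtain ⟨e⟩ := nonempty_homotopyEquiv_inducedCubicalComplex_diff_singleton hX hv hJ
      have := e.symm.pathConnectedSpace
      have := ih _ (hn ▸ ncard_sdiff_singleton_lt_of_mem hv.prop)
        (hX.diff_singleton_of_minimal hv) rfl
      exact e.contractibleSpace

theorem supClosed_cnfDisc {V : Type*} {Φ : Finset (Finset (V × Bool))}
    (hHorn : ∀ C ∈ Φ, (C.filter fun l => l.2 = false).card ≤ 1) : SupClosed (cnfDisc Φ) := by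
  intro x hx y hy C hC
  obtain ⟨⟨i, a⟩, hi, hxi⟩ := hx C hC
  obtain ⟨⟨j, b⟩, hj, hyj⟩ := hy C hC
  dsimp only at hxi hyj
  cases a
  · cases b
    · have := Finset.card_le_one.1 (hHorn C hC) (i, false) (by simp [hi]) (j, false) (by simp [hj])
      obtain rfl : i = j := congrArg Prod.fst this
      exact ⟨_, hi, by simp [hxi, hyj]⟩
    · exact ⟨_, hj, by simp [hyj]⟩
  · exact ⟨_, hi, by simp [hxi]⟩

/-- The solution space of a Dual-Horn SAT formula (at most one negated literal per clause)
is never homotopy equivalent to a sphere of dimension `p ≥ 1`. -/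
theorem dualHornSat_not_homotopyEquiv_sphere
    (d : ℕ) (Φ : Finset (Finset (Fin d × Bool)))
    (hHorn : ∀ C ∈ Φ, (C.filter fun l => l.2 = false).card ≤ 1) (p : ℕ) (hp : 1 ≤ p) :
    ¬ Nonempty (ContinuousMap.HomotopyEquiv
      (inducedCubicalComplex (cnfDisc Φ))
      (Metric.sphere (0 : EuclideanSpace ℝ (Fin (p + 1))) 1)) := by
  rintro ⟨e⟩
  have hrank : 1 < Module.rank ℝ (EuclideanSpace ℝ (Fin (p + 1))) := by
    rw [← Module.finrank_eq_rank, finrank_euclideanSpace_fin]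
    exact_mod_cast Nat.lt_succ_of_le hp
  have := isPathConnected_iff_pathConnectedSpace.1
    (isPathConnected_sphere hrank (0 : EuclideanSpace ℝ (Fin (p + 1))) zero_le_one)
  have := e.pathConnectedSpace
  have := contractibleSpace_inducedCubicalComplex (supClosed_cnfDisc hHorn)
  exact not_contractibleSpace_sphere e.symm.contractibleSpace
end

section
/- Let Φ be a CNF formula over Fin d each of whose clauses contains at most 2 literals (a 2-SAT formula). Then for every D ⊆ Fin d there exists a CNF formula Φ' over the variable set {i : Fin d // i ∉ D}, each of whose clauses contains at most 2 literals, such that disc(Φ') = π_D(disc(Φ)). -/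
/-- The projection forgetting the coordinates in `D`. -/
def proj {d : ℕ} (D : Set (Fin d)) (x : Fin d → Bool) : {i : Fin d // i ∉ D} → Bool :=
  fun i => x i.1

/-- The coordinatewise majority of three assignments. -/
def boolMaj {V : Type*} (x y z : V → Bool) : V → Bool :=
  fun i => (x i && y i) || (x i && z i) || (y i && z i)

theorem boolMaj_apply_eq {V : Type*} {x y z : V → Bool} {i : V} {b : Bool}
    (h : (x i = b ∧ y i = b) ∨ (x i = b ∧ z i = b) ∨ (y i = b ∧ z i = b)) :
    boolMaj x y z i = b := by
  unfold boolMaj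
  generalize x i = p, y i = q, z i = r at h ⊢
  revert b p q r
  decide

/-- The solution space of a 2-SAT formula is closed under majority. -/
theorem boolMaj_mem_cnfDisc {V : Type*} {Φ : Finset (Finset (V × Bool))}
    (hΦ : ∀ C ∈ Φ, C.card ≤ 2) {x y z : V → Bool}
    (hx : x ∈ cnfDisc Φ) (hy : y ∈ cnfDisc Φ) (hz : z ∈ cnfDisc Φ) :
    boolMaj x y z ∈ cnfDisc Φ := by
  intro C hC
  obtain ⟨a, ha, hxa⟩ := hx C hC
  obtain ⟨b, hb, hyb⟩ := hy C hC
  obtain ⟨c, hc, hzc⟩ := hz C hC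
  have hcoll : a = b ∨ a = c ∨ b = c := by
    by_contra! h
    have := Finset.two_lt_card_iff.2 ⟨a, b, c, ha, hb, hc, h⟩
    have := hΦ C hC
    omega
  rcases hcoll with rfl | rfl | rfl
  · exact ⟨a, ha, boolMaj_apply_eq (.inl ⟨hxa, hyb⟩)⟩
  · exact ⟨a, ha, boolMaj_apply_eq (.inr (.inl ⟨hxa, hzc⟩))⟩
  · exact ⟨b, hb, boolMaj_apply_eq (.inr (.inr ⟨hyb, hzc⟩))⟩

/-- In a majority-closed set, an assignment that can be matched on any two coordinates can be
matched on any finite set of coordinates. -/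
theorem exists_eqOn_of_boolMaj_closed {V : Type*} {S : Set (V → Bool)}
    (hS : ∀ x ∈ S, ∀ y ∈ S, ∀ z ∈ S, boolMaj x y z ∈ S) {y : V → Bool}
    (h : ∀ T : Finset V, T.card ≤ 2 → ∃ s ∈ S, ∀ i ∈ T, s i = y i) (T : Finset V) :
    ∃ s ∈ S, ∀ i ∈ T, s i = y i := by
  classical
  induction T using Finset.strongInduction with
  | H T ih =>
    by_cases hT : T.card ≤ 2
    · exact h T hT
    obtain ⟨a, b, c, ha, hb, hc, hab, hac, hbc⟩ := Finset.two_lt_card_iff.1 (not_le.1 hT)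
    obtain ⟨u, hu, hua⟩ := ih _ (Finset.erase_ssubset ha)
    obtain ⟨v, hv, hvb⟩ := ih _ (Finset.erase_ssubset hb)
    obtain ⟨w, hw, hwc⟩ := ih _ (Finset.erase_ssubset hc)
    refine ⟨boolMaj u v w, hS u hu v hv w hw, fun i hi => ?_⟩
    have hu' : i ≠ a → u i = y i := fun hne => hua i (Finset.mem_erase.2 ⟨hne, hi⟩)
    have hv' : i ≠ b → v i = y i := fun hne => hvb i (Finset.mem_erase.2 ⟨hne, hi⟩)
    have hw' : i ≠ c → w i = y i := fun hne => hwc i (Finset.mem_erase.2 ⟨hne, hi⟩)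
    apply boolMaj_apply_eq
    by_cases hia : i = a
    · subst hia
      exact .inr (.inr ⟨hv' hab, hw' hac⟩)
    by_cases hib : i = b
    · subst hib
      exact .inr (.inl ⟨hu' hia, hw' hbc⟩)
    · exact .inl ⟨hu' hia, hv' hib⟩

/-- A majority-closed set of assignments of finitely many variables is the solution space of a
2-SAT formula. -/
theorem exists_twoSat_cnfDisc_eq {V : Type*} [Finite V] {S : Set (V → Bool)}
    (hS : ∀ x ∈ S, ∀ y ∈ S, ∀ z ∈ S, boolMaj x y z ∈ S) :
    ∃ Φ : Finset (Finset (V × Bool)), (∀ C ∈ Φ, C.card ≤ 2) ∧ cnfDisc Φ = S := by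
  classical
  cases nonempty_fintype V
  refine ⟨Finset.univ.filter fun C => C.card ≤ 2 ∧ ∀ s ∈ S, ∃ l ∈ C, s l.1 = l.2,
    fun C hC => (Finset.mem_filter.1 hC).2.1, Set.Subset.antisymm (fun y hy => ?_)
    fun s hs C hC => (Finset.mem_filter.1 hC).2.2 s hs⟩
  obtain ⟨s, hs, hsy⟩ := exists_eqOn_of_boolMaj_closed hS (y := y) (fun T hT => by
    by_contra! hne
    obtain ⟨l, hl, hyl⟩ := hy (T.image fun i => (i, !y i)) (Finset.mem_filter.2
      ⟨Finset.mem_univ _, Finset.card_image_le.trans hT, fun s hs => by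
        obtain ⟨i, hi, hsi⟩ := hne s hs
        exact ⟨(i, !y i), Finset.mem_image_of_mem _ hi, Bool.eq_not.2 hsi⟩⟩)
    obtain ⟨i, -, rfl⟩ := Finset.mem_image.1 hl
    simp at hyl) Finset.univ
  rwa [← funext fun i => hsy i (Finset.mem_univ i)]

/-- Projections of solution spaces of this SAT fragment are again solution spaces of
formulas of the same fragment. -/
theorem twoSat_projection_closed
    (d : ℕ) (Φ : Finset (Finset (Fin d × Bool)))
    (hΦ : ∀ C ∈ Φ, C.card ≤ 2) (D : Set (Fin d)) :
    ∃ Φ' : Finset (Finset ({i : Fin d // i ∉ D} × Bool)),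
      (∀ C' ∈ Φ', C'.card ≤ 2) ∧
      cnfDisc Φ' = proj D '' cnfDisc Φ := by
  apply exists_twoSat_cnfDisc_eq
  rintro _ ⟨x, hx, rfl⟩ _ ⟨y, hy, rfl⟩ _ ⟨z, hz, rfl⟩
  exact ⟨boolMaj x y z, boolMaj_mem_cnfDisc hΦ hx hy hz, rfl⟩
end

section
/- Let Φ be a CNF formula over Fin d each of whose clauses contains at most one positive literal, i.e. at most one literal of the form (i, true) (a Horn SAT formula). Then for every D ⊆ Fin d there exists a CNF formula Φ' over the variable set {i : Fin d // i ∉ D}, each of whose clauses contains at most one positive literal, such that disc(Φ') = π_D(disc(Φ)). -/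
/-- The solution space of a Horn formula is closed under pointwise conjunction. -/
theorem infClosed_cnfDisc {V : Type*} {Φ : Finset (Finset (V × Bool))}
    (hΦ : ∀ C ∈ Φ, (C.filter fun l => l.2 = true).card ≤ 1) : InfClosed (cnfDisc Φ) := by
  intro x hx y hy C hC
  obtain ⟨⟨i, a⟩, hi, hxi⟩ := hx C hC
  obtain ⟨⟨j, b⟩, hj, hyj⟩ := hy C hC
  cases a
  · exact ⟨_, hi, by simp_all⟩
  cases b
  · exact ⟨_, hj, by simp_all⟩
  have hij : (i, true) = (j, true) :=
    Finset.card_le_one.1 (hΦ C hC) _ (by simpa using hi) _ (by simpa using hj)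
  obtain rfl : i = j := congrArg Prod.fst hij
  exact ⟨_, hi, by simp_all⟩

/-- Every set of assignments closed under pointwise conjunction is the solution space of a
Horn formula. -/
theorem InfClosed.exists_cnfDisc_eq {V : Type*} [Finite V] {S : Set (V → Bool)}
    (hS : InfClosed S) :
    ∃ Φ : Finset (Finset (V × Bool)),
      (∀ C ∈ Φ, (C.filter fun l => l.2 = true).card ≤ 1) ∧ cnfDisc Φ = S := by
  classical
  have := Fintype.ofFinite V
  let Φ : Finset (Finset (V × Bool)) := Finset.univ.filter fun C =>
    (C.filter fun l => l.2 = true).card ≤ 1 ∧ ∀ s ∈ S, ∃ l ∈ C, s l.1 = l.2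
  refine ⟨Φ, fun C hC => (Finset.mem_filter.1 hC).2.1, Set.Subset.antisymm (fun y hy => ?_)
    fun s hs C hC => (Finset.mem_filter.1 hC).2.2 s hs⟩
  have entailed (C : Finset (V × Bool)) (hC : (C.filter fun l => l.2 = true).card ≤ 1)
      (hCS : ∀ s ∈ S, ∃ l ∈ C, s l.1 = l.2) : ∃ l ∈ C, y l.1 = l.2 :=
    hy C (Finset.mem_filter.2 ⟨Finset.mem_univ _, hC, hCS⟩)
  let N : Finset (V × Bool) := Finset.univ.filter fun l => y l.1 = true ∧ l.2 = false
  have falsified (s : V → Bool) (h : ¬y ≤ s) : ∃ l ∈ N, s l.1 = l.2 := by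
    obtain ⟨i, hi⟩ := not_forall.1 h
    refine ⟨(i, false), ?_⟩
    cases hyi : y i <;> cases hsi : s i <;> simp_all [N]
  have hN : N.filter (fun l => l.2 = true) = ∅ := by
    ext l; simp +contextual [N]
  have hyN : ¬∃ l ∈ N, y l.1 = l.2 := by
    rintro ⟨l, hl, hyl⟩
    simp_all [N]
  have hne : {s ∈ S | y ≤ s}.Nonempty := by
    by_contra h
    refine hyN (entailed N (by simp [hN]) fun s hs => falsified s fun hys => h ⟨s, hs, hys⟩)
  obtain ⟨m, ⟨hmS, hym⟩, hmin⟩ := (Set.toFinite {s ∈ S | y ≤ s}).exists_minimal hne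
  have least (s : V → Bool) (hs : s ∈ S) (hys : y ≤ s) : m ≤ s :=
    (hmin ⟨hS hmS hs, le_inf hym hys⟩ inf_le_left).trans inf_le_right
  suffices hmy : m ≤ y from le_antisymm hmy hym ▸ hmS
  intro j hmj
  obtain ⟨l, hl, hyl⟩ := entailed (insert (j, true) N)
    (by rw [Finset.filter_insert, hN]; simp) fun s hs => by
      by_cases hys : y ≤ s
      · exact ⟨(j, true), Finset.mem_insert_self _ _, least s hs hys j hmj⟩
      · obtain ⟨l, hl, hsl⟩ := falsified s hys
        exact ⟨l, Finset.mem_insert_of_mem hl, hsl⟩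
  obtain rfl | hl := Finset.mem_insert.1 hl
  · exact hyl
  · exact (hyN ⟨l, hl, hyl⟩).elim

/-- Projections of solution spaces of this SAT fragment are again solution spaces of
formulas of the same fragment. -/
theorem hornSat_projection_closed
    (d : ℕ) (Φ : Finset (Finset (Fin d × Bool)))
    (hΦ : ∀ C ∈ Φ, (C.filter fun l => l.2 = true).card ≤ 1) (D : Set (Fin d)) :
    ∃ Φ' : Finset (Finset ({i : Fin d // i ∉ D} × Bool)),
      (∀ C' ∈ Φ', (C'.filter fun l => l.2 = true).card ≤ 1) ∧
      cnfDisc Φ' = proj D '' cnfDisc Φ := by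
  refine InfClosed.exists_cnfDisc_eq ?_
  rintro _ ⟨x, hx, rfl⟩ _ ⟨y, hy, rfl⟩
  exact ⟨x ⊓ y, infClosed_cnfDisc hΦ hx hy, rfl⟩
end

section
/- Let Φ be a 1-in-3-SAT formula over Fin d, i.e. a finite set of constraints, each given by a triple of literals ((i₁,b₁),(i₂,b₂),(i₃,b₃)), where an assignment x : Fin d → Bool satisfies the constraint iff exactly one of the equalities x i₁ = b₁, x i₂ = b₂, x i₃ = b₃ holds, and disc(Φ) is the set of assignments satisfying all constraints. Then the induced cubical complex N(disc(Φ)) is homotopy equivalent to a finite discrete space: there exists a finite set F of points of (Fin d → ℝ) (with the subspace topology, which is discrete) such that N(disc(Φ)) is homotopy equivalent to F. -/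
/-- Exactly one of three propositions holds. -/
def ExactlyOne (a b c : Prop) : Prop :=
  (a ∧ ¬b ∧ ¬c) ∨ (¬a ∧ b ∧ ¬c) ∨ (¬a ∧ ¬b ∧ c)

/-- The discrete solution space of a 1-in-3-SAT formula: a constraint is a triple of
literals, and an assignment satisfies it iff exactly one of the three literals is true. -/
def oneInThreeDisc {d : ℕ}
    (Φ : Finset ((Fin d × Bool) × (Fin d × Bool) × (Fin d × Bool))) :
    Set (Fin d → Bool) :=
  {x | ∀ c ∈ Φ,
    ExactlyOne (x c.1.1 = c.1.2) (x c.2.1.1 = c.2.1.2) (x c.2.2.1 = c.2.2.2)}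

open Classical in
/-- The coordinates along which a set of Boolean vertices is invariant under flipping. -/
noncomputable def freeCoords {V : Type*} (X : Set (V → Bool)) : Set V :=
  {i | ∀ y ∈ X, Function.update y i (!y i) ∈ X}

open Classical in
/-- Set the free coordinates of a point to zero. -/
noncomputable def collapseFree {V : Type*} (X : Set (V → Bool)) (p : V → ℝ) : V → ℝ :=
  fun i => if i ∈ freeCoords X then 0 else p i

/-- If flipping the coordinate `j` preserves one satisfying assignment of a one-in-three
constraint, it preserves all of them. -/
lemma exactlyOne_update_of_exactlyOne_update {V : Type*} [DecidableEq V]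
    (a b c : V × Bool) (j : V) (x y : V → Bool)
    (hx : ExactlyOne (x a.1 = a.2) (x b.1 = b.2) (x c.1 = c.2))
    (hx' : ExactlyOne (Function.update x j (!x j) a.1 = a.2)
      (Function.update x j (!x j) b.1 = b.2) (Function.update x j (!x j) c.1 = c.2))
    (hy : ExactlyOne (y a.1 = a.2) (y b.1 = b.2) (y c.1 = c.2)) :
    ExactlyOne (Function.update y j (!y j) a.1 = a.2)
      (Function.update y j (!y j) b.1 = b.2) (Function.update y j (!y j) c.1 = c.2) := by
  obtain ⟨a, a'⟩ := a
  obtain ⟨b, b'⟩ := b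
  obtain ⟨c, c'⟩ := c
  simp only [ExactlyOne, Function.update_apply] at *
  cases a' <;> cases b' <;> cases c' <;> split_ifs at * <;> subst_vars <;> grind

lemma mem_freeCoords_oneInThreeDisc {d : ℕ}
    (Φ : Finset ((Fin d × Bool) × (Fin d × Bool) × (Fin d × Bool)))
    (j : Fin d) (x : Fin d → Bool) (hx : x ∈ oneInThreeDisc Φ)
    (hx' : Function.update x j (!x j) ∈ oneInThreeDisc Φ) :
    j ∈ freeCoords (oneInThreeDisc Φ) := by
  intro y hy c hc
  have := exactlyOne_update_of_exactlyOne_update c.1 c.2.1 c.2.2 j x y (hx c hc) (hx' c hc)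
    (hy c hc)
  convert this

lemma mem_of_eq_off_freeCoords {V : Type*} [Finite V] {X : Set (V → Bool)} {v w : V → Bool}
    (hw : w ∈ X) (h : ∀ i ∉ freeCoords X, v i = w i) : v ∈ X := by
  classical
  cases nonempty_fintype V
  have key : ∀ s : Finset V, (fun i => if i ∈ s then v i else w i) ∈ X := by
    intro s
    induction s using Finset.induction_on with
    | empty => simpa using hw
    | insert a s ha ih =>
      by_cases hva : v a = w a
      · convert ih using 2 with i
        by_cases hi : i = a <;> simp_all
      · have hfree : a ∈ freeCoords X := by
          by_contra hn
          exact hva (h a hn)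
        convert hfree _ ih using 1
        funext i
        by_cases hi : i = a
        · subst hi
          cases hv : v i <;> cases hw' : w i <;> simp_all
        · simp [hi]
  simpa using key Finset.univ

lemma mem_inducedCubicalComplex_of_eq_off_freeCoords {V : Type*} [Finite V]
    {X : Set (V → Bool)} {p q : V → ℝ} (hp : p ∈ inducedCubicalComplex X)
    (hq : ∀ i, 0 ≤ q i ∧ q i ≤ 1) (h : ∀ i ∉ freeCoords X, q i = p i) :
    q ∈ inducedCubicalComplex X := by
  classical
  refine ⟨hq, fun v hv => ?_⟩
  refine mem_of_eq_off_freeCoords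
    (w := fun i => if i ∈ freeCoords X then decide (p i = 1) else v i)
    (hp.2 _ fun i => ?_) fun i hi => by simp [hi]
  by_cases hi : i ∈ freeCoords X
  · simp +contextual [hi]
  · simpa [hi, h i hi] using hv i

lemma collapseFree_mem_inducedCubicalComplex {V : Type*} [Finite V] {X : Set (V → Bool)}
    {p : V → ℝ} (hp : p ∈ inducedCubicalComplex X) :
    collapseFree X p ∈ inducedCubicalComplex X := by
  refine mem_inducedCubicalComplex_of_eq_off_freeCoords hp (fun i => ?_) fun i hi => ?_
  · unfold collapseFree
    split_ifs
    · simp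
    · exact hp.1 i
  · simp [collapseFree, hi]

lemma collapseFree_collapseFree {V : Type*} (X : Set (V → Bool)) (p : V → ℝ) :
    collapseFree X (collapseFree X p) = collapseFree X p := by
  funext i
  by_cases hi : i ∈ freeCoords X <;> simp [collapseFree, hi]

lemma continuous_collapseFree {V : Type*} (X : Set (V → Bool)) :
    Continuous (collapseFree X) := by
  refine continuous_pi fun i => ?_
  by_cases hi : i ∈ freeCoords X
  · simpa [collapseFree, hi] using continuous_const
  · simpa [collapseFree, hi] using continuous_apply i

/-- Collapsing the free coordinates is a deformation retraction. -/
lemma nonempty_homotopyEquiv_image_collapseFree {V : Type*} [Finite V] (X : Set (V → Bool)) :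
    Nonempty (ContinuousMap.HomotopyEquiv (inducedCubicalComplex X)
      (collapseFree X '' inducedCubicalComplex X)) := by
  have hsub : collapseFree X '' inducedCubicalComplex X ⊆ inducedCubicalComplex X := by
    rintro _ ⟨p, hp, rfl⟩
    exact collapseFree_mem_inducedCubicalComplex hp
  have hcont := continuous_collapseFree X
  let f : C(inducedCubicalComplex X, collapseFree X '' inducedCubicalComplex X) :=
    ⟨fun p => ⟨collapseFree X p, p, p.2, rfl⟩, by fun_prop⟩
  let g : C(collapseFree X '' inducedCubicalComplex X, inducedCubicalComplex X) :=
    ⟨Set.inclusion hsub, continuous_inclusion hsub⟩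
  refine ⟨⟨f, g, ⟨?_⟩, ?_⟩⟩
  · refine ⟨⟨fun tp => ⟨fun i => (1 - (tp.1 : ℝ)) * collapseFree X tp.2 i
        + (tp.1 : ℝ) * (tp.2 : V → ℝ) i, ?_⟩, ?_⟩, fun p => ?_, fun p => ?_⟩
    · obtain ⟨⟨t, ht0, ht1⟩, p, hp⟩ := tp
      have hp' := collapseFree_mem_inducedCubicalComplex hp
      refine mem_inducedCubicalComplex_of_eq_off_freeCoords hp (fun i => ?_) fun i hi => ?_
      · have h1 := hp.1 i
        have h2 := hp'.1 i
        constructor <;> dsimp only <;> nlinarith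
      · simp only [collapseFree, hi, if_false]
        ring
    · refine Continuous.subtype_mk (continuous_pi fun i => ?_) _
      have hval : Continuous fun tp : unitInterval × inducedCubicalComplex X =>
        (tp.2 : V → ℝ) := continuous_subtype_val.comp continuous_snd
      have ht : Continuous fun tp : unitInterval × inducedCubicalComplex X =>
        (tp.1 : ℝ) := continuous_subtype_val.comp continuous_fst
      exact ((continuous_const.sub ht).mul
        ((continuous_apply i).comp (hcont.comp hval))).add
        (ht.mul ((continuous_apply i).comp hval))
    · ext i
      simp [f, g]
    · ext i
      simp
  · have : f.comp g = ContinuousMap.id _ := by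
      ext ⟨_, p, hp, rfl⟩ : 2
      exact collapseFree_collapseFree X p
    rw [this]

lemma finite_image_collapseFree_oneInThreeDisc {d : ℕ}
    (Φ : Finset ((Fin d × Bool) × (Fin d × Bool) × (Fin d × Bool))) :
    (collapseFree (oneInThreeDisc Φ) '' inducedCubicalComplex (oneInThreeDisc Φ)).Finite := by
  refine (Set.Finite.pi' (t := fun _ : Fin d => ({0, 1} : Set ℝ))
    fun _ => Set.toFinite _).subset ?_
  rintro _ ⟨p, hp, rfl⟩ i
  by_cases hi : i ∈ freeCoords (oneInThreeDisc Φ)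
  · simp [collapseFree, hi]
  · by_contra hne
    simp only [collapseFree, hi, if_false, Set.mem_insert_iff, Set.mem_singleton_iff,
      not_or] at hne
    refine hi (mem_freeCoords_oneInThreeDisc Φ i (fun k => decide (p k = 1))
      (hp.2 _ fun k => ?_) (hp.2 _ fun k => ?_))
    · simp +contextual
    · by_cases hk : k = i
      · subst hk
        simp [hne]
      · simp +contextual [hk]

/-- The solution space of a 1-in-3-SAT formula is homotopy equivalent to a finite
discrete space. -/
theorem oneInThreeSat_homotopyEquiv_finite_discrete
    (d : ℕ) (Φ : Finset ((Fin d × Bool) × (Fin d × Bool) × (Fin d × Bool))) :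
    ∃ F : Finset (Fin d → ℝ),
      Nonempty (ContinuousMap.HomotopyEquiv
        (inducedCubicalComplex (oneInThreeDisc Φ)) (↑F : Set (Fin d → ℝ))) := by
  have hfin := finite_image_collapseFree_oneInThreeDisc Φ
  refine ⟨hfin.toFinset, ?_⟩
  rw [hfin.coe_toFinset]
  exact nonempty_homotopyEquiv_image_collapseFree _
end

section
/- (3,2,2)-SAT is homotopy-universal for finite simplicial complexes: for every geometric simplicial complex K in a Euclidean space (Fin n → ℝ) with finitely many faces, there exist a natural number d and a CNF formula Φ over Fin d, each of whose clauses contains at most 3 literals, among them at most 2 positive literals (literals of the form (i, true)) and at most 2 negated literals (literals of the form (i, false)), such that the induced cubical complex N(disc(Φ)) is homotopy equivalent to the underlying space |K| of K. -/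
namespace CubicalSAT

open Finset

section Homotopy

variable {X E : Type*} [TopologicalSpace X] [TopologicalSpace E] {S : Set E}

/-- A continuous family of points of `S` parametrized by `[0, 1]` is a homotopy in `S`. -/
lemma homotopic_of_continuous (f g : C(X, S)) (H : ℝ × X → E) (hH : Continuous H)
    (h0 : ∀ x, H (0, x) = f x) (h1 : ∀ x, H (1, x) = g x)
    (hS : ∀ t, 0 ≤ t → t ≤ 1 → ∀ x, H (t, x) ∈ S) : f.Homotopic g :=
  ⟨{ toFun := fun q => ⟨H (q.1, q.2), hS _ q.1.2.1 q.1.2.2 _⟩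
     continuous_toFun := by
       refine Continuous.subtype_mk (hH.comp ?_) _
       fun_prop
     map_zero_left := fun x => Subtype.ext (by simpa using h0 x)
     map_one_left := fun x => Subtype.ext (by simpa using h1 x) }⟩

/-- Two maps into `S` joined by straight segments inside `S` are homotopic. -/
lemma homotopic_of_segment [AddCommGroup E] [Module ℝ E] [ContinuousAdd E] [ContinuousSMul ℝ E]
    (f g : C(X, S))
    (hS : ∀ t : ℝ, 0 ≤ t → t ≤ 1 → ∀ x, (1 - t) • (f x : E) + t • (g x : E) ∈ S) :
    f.Homotopic g :=
  homotopic_of_continuous f g (fun q => (1 - q.1) • (f q.2 : E) + q.1 • (g q.2 : E))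
    (by fun_prop) (by simp) (by simp) hS

end Homotopy

/-- The truncation of a real number to the unit interval. -/
noncomputable def unitClamp (r : ℝ) : ℝ := max 0 (min 1 r)

lemma continuous_unitClamp : Continuous unitClamp := by unfold unitClamp; fun_prop

lemma unitClamp_nonneg (r : ℝ) : 0 ≤ unitClamp r := le_max_left _ _

lemma unitClamp_le_one (r : ℝ) : unitClamp r ≤ 1 := by simp [unitClamp]

lemma unitClamp_eq_zero {r : ℝ} (h : r ≤ 0) : unitClamp r = 0 :=
  max_eq_left ((min_le_right _ _).trans h)

lemma unitClamp_eq_one {r : ℝ} (h : 1 ≤ r) : unitClamp r = 1 := by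
  simp [unitClamp, min_eq_left h]

lemma pos_of_unitClamp_ne_zero {r : ℝ} (h : unitClamp r ≠ 0) : 0 < r := by
  by_contra hr
  exact h (unitClamp_eq_zero (not_lt.1 hr))

lemma unitClamp_pos {r : ℝ} (h : 0 < r) : 0 < unitClamp r := by simp [unitClamp, h]

section Solutions

/-- A point of the cube lies in the cubical complex of a formula without tautological clauses
iff every clause has a literal that it satisfies exactly. -/
lemma mem_inducedCubicalComplex_cnfDisc {V : Type*} (Φ : Finset (Finset (V × Bool)))
    (hΦ : ∀ C ∈ Φ, ∀ i, (i, true) ∈ C → (i, false) ∉ C) (p : V → ℝ) :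
    p ∈ inducedCubicalComplex (cnfDisc Φ) ↔
      (∀ i, 0 ≤ p i ∧ p i ≤ 1) ∧ ∀ C ∈ Φ, ∃ l ∈ C, p l.1 = if l.2 then 1 else 0 := by
  classical
  refine and_congr_right fun _ => ⟨fun h C hC => ?_, fun h v hv C hC => ?_⟩
  · obtain ⟨⟨i, b⟩, hl, hv⟩ := h
      (fun i => if p i = 0 then false else if p i = 1 then true else decide ((i, false) ∈ C))
      (fun i => ⟨fun h => by simp [h], fun h => by simp [h]⟩) C hC
    refine ⟨(i, b), hl, ?_⟩
    have := hΦ C hC i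
    cases b <;> simp at hv ⊢ <;> grind
  · obtain ⟨⟨i, b⟩, hl, hp⟩ := h C hC
    refine ⟨(i, b), hl, ?_⟩
    cases b
    · exact (hv i).1 (by simpa using hp)
    · exact (hv i).2 (by simpa using hp)

variable {m : ℕ} (R : Fin m → Fin m → Prop)

open Classical in
/-- The formula expressing that some variable `x i` holds and no two `R`-related ones do. The
long disjunction is broken up by auxiliary variables `y k`, standing for `x j` for some `k ≤ j`. -/
noncomputable def chainFormula : Finset (Finset (Fin (m + (m + 1)) × Bool)) :=
  ((univ.filter fun q : Fin m × Fin m => R q.1 q.2).image fun q =>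
      {(Fin.castAdd _ q.1, false), (Fin.castAdd _ q.2, false)}) ∪
    {{(Fin.natAdd m 0, true)}, {(Fin.natAdd m (Fin.last m), false)}} ∪
    univ.image fun k : Fin m => {(Fin.natAdd m k.castSucc, false), (Fin.castAdd _ k, true),
      (Fin.natAdd m k.succ, true)}

/-- The cubical complex of `chainFormula R` in separated coordinates. -/
def chainSolutions : Set ((Fin m → ℝ) × (Fin (m + 1) → ℝ)) :=
  {q | ((∀ i, 0 ≤ q.1 i ∧ q.1 i ≤ 1) ∧ ∀ k, 0 ≤ q.2 k ∧ q.2 k ≤ 1) ∧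
    (∀ i j, R i j → q.1 i = 0 ∨ q.1 j = 0) ∧ q.2 0 = 1 ∧ q.2 (Fin.last m) = 0 ∧
    ∀ k : Fin m, q.2 k.castSucc = 0 ∨ q.1 k = 1 ∨ q.2 k.succ = 1}

/-- Nonzero nonnegative vectors whose support is `R`-independent. -/
def independentCone : Set (Fin m → ℝ) :=
  {x | (∀ i, 0 ≤ x i) ∧ (∃ i, 0 < x i) ∧ ∀ i j, R i j → x i = 0 ∨ x j = 0}

lemma forall_mem_chainFormula {P : Finset (Fin (m + (m + 1)) × Bool) → Prop} :
    (∀ C ∈ chainFormula R, P C) ↔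
      (∀ i j, R i j → P {(Fin.castAdd _ i, false), (Fin.castAdd _ j, false)}) ∧
      P {(Fin.natAdd m 0, true)} ∧ P {(Fin.natAdd m (Fin.last m), false)} ∧
      ∀ k : Fin m, P {(Fin.natAdd m k.castSucc, false), (Fin.castAdd _ k, true),
        (Fin.natAdd m k.succ, true)} := by
  simp only [chainFormula, mem_union, mem_image, mem_filter, mem_univ, true_and, mem_insert,
    mem_singleton]
  constructor
  · intro h
    exact ⟨fun i j hij => h _ (.inl (.inl ⟨(i, j), hij, rfl⟩)), h _ (.inl (.inr (.inl rfl))),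
      h _ (.inl (.inr (.inr rfl))), fun k => h _ (.inr ⟨k, rfl⟩)⟩
  · rintro ⟨h1, h2, h3, h4⟩ C ((⟨q, hq, rfl⟩ | rfl | rfl) | ⟨k, rfl⟩)
    exacts [h1 _ _ hq, h2, h3, h4 k]

lemma card_of_mem_chainFormula {C : Finset (Fin (m + (m + 1)) × Bool)} (hC : C ∈ chainFormula R) :
    C.card ≤ 3 ∧ (C.filter fun l => l.2 = true).card ≤ 2 ∧
      (C.filter fun l => l.2 = false).card ≤ 2 := by
  revert C
  rw [forall_mem_chainFormula]
  refine ⟨fun i j _ => ⟨card_le_two.trans (by lia), ?_, ?_⟩, by simp [filter_singleton],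
    by simp [filter_singleton], fun k => ⟨card_le_three, ?_, ?_⟩⟩
  · simp [filter_insert, filter_singleton]
  · exact (card_filter_le _ _).trans card_le_two
  · simpa [filter_insert, filter_singleton] using card_le_two
  · simp [filter_insert, filter_singleton]

lemma not_tautology_of_mem_chainFormula {C : Finset (Fin (m + (m + 1)) × Bool)}
    (hC : C ∈ chainFormula R) : ∀ i, (i, true) ∈ C → (i, false) ∉ C := by
  revert C
  rw [forall_mem_chainFormula]
  refine ⟨by simp, by simp, by simp, fun k i => ?_⟩
  simp only [mem_insert, mem_singleton, Prod.mk.injEq]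
  have := k.isLt
  rintro (⟨-, h⟩ | ⟨rfl, -⟩ | ⟨rfl, -⟩)
  · simp at h
  · simp [Fin.ext_iff]
    lia
  · simp [Fin.ext_iff]

/-- The cubical complex of `chainFormula R` is homeomorphic to `chainSolutions R`. -/
noncomputable def chainSolutionsHomeomorph :
    chainSolutions R ≃ₜ inducedCubicalComplex (cnfDisc (chainFormula R)) :=
  (Fin.appendHomeomorph (X := ℝ) m (m + 1)).subtype fun q => by
    change _ ↔ Fin.append q.1 q.2 ∈ inducedCubicalComplex (cnfDisc (chainFormula R))
    rw [mem_inducedCubicalComplex_cnfDisc _ fun _ => not_tautology_of_mem_chainFormula R,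
      forall_mem_chainFormula, Fin.forall_fin_add]
    simp [chainSolutions, -Fin.natAdd_last]

end Solutions

section Projection

variable {m : ℕ}

/-- The maximum of `0` and the coordinates of `x` of index less than `k`. -/
def prefixMax (k : Fin (m + 1)) (x : Fin m → ℝ) : ℝ :=
  (univ.filter fun j : Fin m => j.castSucc < k).fold max 0 x

lemma continuous_prefixMax (k : Fin (m + 1)) : Continuous (prefixMax k) := by
  unfold prefixMax
  induction (univ.filter fun j : Fin m => j.castSucc < k) using Finset.induction_on with
  | empty => simpa using continuous_const
  | insert a s ha ih => simp only [fold_insert ha]; fun_prop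

lemma prefixMax_le {k : Fin (m + 1)} {x : Fin m → ℝ} {c : ℝ} :
    prefixMax k x ≤ c ↔ 0 ≤ c ∧ ∀ j : Fin m, j.castSucc < k → x j ≤ c := by
  simp [prefixMax, fold_max_le]

lemma le_prefixMax {k : Fin (m + 1)} (x : Fin m → ℝ) {j : Fin m} (h : j.castSucc < k) :
    x j ≤ prefixMax k x :=
  (prefixMax_le.1 le_rfl).2 j h

lemma prefixMax_succ_le {k : Fin m} {x : Fin m → ℝ} {c : ℝ} (h : prefixMax k.castSucc x ≤ c)
    (hk : x k ≤ c) : prefixMax k.succ x ≤ c := by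
  rw [prefixMax_le] at h ⊢
  refine ⟨h.1, fun j hj => ?_⟩
  rcases (Fin.castSucc_lt_succ_iff.1 hj).lt_or_eq with hlt | rfl
  exacts [h.2 j (Fin.castSucc_lt_castSucc_iff.2 hlt), hk]

/-- Scaling by `m + 1` and truncating. -/
noncomputable def saturate (x : Fin m → ℝ) (i : Fin m) : ℝ := unitClamp ((m + 1) * x i)

/-- A continuous choice of the auxiliary variables over the saturation of `x`. -/
noncomputable def auxValue (x : Fin m → ℝ) (k : Fin (m + 1)) : ℝ :=
  unitClamp (k + 1 - (m + 1) * prefixMax k x)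

/-- Factors lowering the auxiliary variables to zero one after the other. -/
noncomputable def dampFactor (t : ℝ) (k : Fin (m + 1)) : ℝ := unitClamp (k + 1 - (m + 1) * t)

lemma continuous_saturate : Continuous (saturate (m := m)) :=
  continuous_pi fun i => continuous_unitClamp.comp (by fun_prop)

lemma continuous_auxValue : Continuous (auxValue (m := m)) :=
  continuous_pi fun k => continuous_unitClamp.comp
    (continuous_const.sub (continuous_const.mul (continuous_prefixMax k)))

lemma continuous_dampFactor : Continuous (dampFactor (m := m)) :=
  continuous_pi fun k => continuous_unitClamp.comp (by fun_prop)

lemma saturate_eq_zero {x : Fin m → ℝ} {i : Fin m} (h : x i = 0) : saturate x i = 0 :=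
  unitClamp_eq_zero (by simp [h])

lemma saturate_eq_one {x : Fin m → ℝ} {i : Fin m} (h : x i = 1) : saturate x i = 1 :=
  unitClamp_eq_one (by simp [h])

lemma saturate_pos {x : Fin m → ℝ} {i : Fin m} (h : 0 < x i) : 0 < saturate x i :=
  unitClamp_pos (by positivity)

lemma auxValue_zero (x : Fin m → ℝ) : auxValue x 0 = 1 := by
  apply unitClamp_eq_one
  have : prefixMax 0 x ≤ 0 := prefixMax_le.2 ⟨le_rfl, fun j hj => absurd hj (by simp)⟩
  have hm : (0 : ℝ) ≤ m + 1 := by positivity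
  have := mul_nonpos_of_nonneg_of_nonpos hm this
  simp only [Fin.val_zero, Nat.cast_zero]
  linarith

lemma auxValue_eq_zero {x : Fin m → ℝ} {k : Fin (m + 1)} {j : Fin m} (hj : j.castSucc < k)
    (hx : x j = 1) : auxValue x k = 0 := by
  apply unitClamp_eq_zero
  have h : 1 ≤ prefixMax k x := hx ▸ le_prefixMax x hj
  have hk : (k : ℝ) ≤ m := by exact_mod_cast Nat.lt_succ_iff.1 k.2
  nlinarith

lemma auxValue_step (x : Fin m → ℝ) (k : Fin m) :
    auxValue x k.castSucc = 0 ∨ saturate x k = 1 ∨ auxValue x k.succ = 1 := by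
  by_contra! h
  obtain ⟨h1, h2, h3⟩ := h
  have h1 := pos_of_unitClamp_ne_zero h1
  have h2 : (m + 1) * x k < 1 := lt_of_not_ge fun h => h2 (unitClamp_eq_one h)
  refine h3 (unitClamp_eq_one ?_)
  have hm : (0 : ℝ) < m + 1 := by positivity
  have hk : (0 : ℝ) ≤ (k : ℕ) := by positivity
  simp only [Fin.val_castSucc] at h1
  have : prefixMax k.succ x ≤ ((k : ℕ) + 1) / (m + 1) := by
    apply prefixMax_succ_le <;> rw [le_div_iff₀ hm] <;> linarith
  rw [le_div_iff₀ hm] at this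
  simp only [Fin.val_succ]
  push_cast
  linarith

lemma dampFactor_zero (k : Fin (m + 1)) : dampFactor 0 k = 1 :=
  unitClamp_eq_one (by simp)

lemma dampFactor_one (k : Fin (m + 1)) : dampFactor 1 k = 0 := by
  apply unitClamp_eq_zero
  have hk : (k : ℝ) ≤ m := by exact_mod_cast Nat.lt_succ_iff.1 k.2
  linarith

lemma dampFactor_step (t : ℝ) (k : Fin m) :
    dampFactor t k.castSucc = 0 ∨ dampFactor t k.succ = 1 := by
  by_contra! h
  have h1 := pos_of_unitClamp_ne_zero h.1
  refine h.2 (unitClamp_eq_one ?_)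
  simp only [Fin.val_castSucc] at h1
  simp only [Fin.val_succ]
  push_cast
  linarith

variable {R : Fin m → Fin m → Prop}

/-- In a solution, an auxiliary variable equals `1` unless an earlier `x j` does. -/
lemma exists_lt_or_eq_one {q} (hq : q ∈ chainSolutions R) (k : Fin (m + 1)) :
    (∃ j : Fin m, j.castSucc < k ∧ q.1 j = 1) ∨ q.2 k = 1 := by
  obtain ⟨-, -, h0, -, hstep⟩ := hq
  induction k using Fin.induction with
  | zero => exact .inr h0
  | succ k ih =>
    rcases ih with ⟨j, hj, hx⟩ | hy
    · exact .inl ⟨j, hj.trans Fin.castSucc_lt_succ, hx⟩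
    · rcases hstep k with h | h | h
      · simp [h] at hy
      · exact .inl ⟨k, Fin.castSucc_lt_succ, h⟩
      · exact .inr h

lemma exists_eq_one {q} (hq : q ∈ chainSolutions R) : ∃ j, q.1 j = 1 := by
  rcases exists_lt_or_eq_one hq (Fin.last m) with ⟨j, -, h⟩ | h
  · exact ⟨j, h⟩
  · simp [hq.2.2.2.1] at h

lemma auxValue_le {q} (hq : q ∈ chainSolutions R) (k : Fin (m + 1)) : auxValue q.1 k ≤ q.2 k := by
  rcases exists_lt_or_eq_one hq k with ⟨j, hj, h⟩ | h
  · rw [auxValue_eq_zero hj h]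
    exact (hq.1.2 k).1
  · rw [h]
    exact unitClamp_le_one _

lemma norm_eq_one {q} (hq : q ∈ chainSolutions R) : ‖q.1‖ = 1 := by
  obtain ⟨j, hj⟩ := exists_eq_one hq
  refine le_antisymm ((pi_norm_le_iff_of_nonneg zero_le_one).2 fun i => ?_) ?_
  · rw [Real.norm_of_nonneg (hq.1.1 i).1]
    exact (hq.1.1 i).2
  · simpa [hj] using norm_le_pi_norm q.1 j

lemma norm_pos_of_mem {x : Fin m → ℝ} (hx : x ∈ independentCone R) : 0 < ‖x‖ := by
  obtain ⟨i, hi⟩ := hx.2.1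
  exact norm_pos_iff.2 fun h => by simp [h] at hi

lemma exists_normalized_eq_one {x : Fin m → ℝ} (hx : x ∈ independentCone R) :
    ∃ j, (‖x‖⁻¹ • x) j = 1 := by
  have hpos := norm_pos_of_mem hx
  by_contra! h
  have : ‖x‖ < ‖x‖ := by
    refine (pi_norm_lt_iff hpos).2 fun j => lt_of_le_of_ne (norm_le_pi_norm x j) fun hj => h j ?_
    rw [Real.norm_of_nonneg (hx.1 j)] at hj
    simp only [Pi.smul_apply, smul_eq_mul]
    rw [hj]
    exact inv_mul_cancel₀ hpos.ne'
  exact this.false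

lemma section_mem {x : Fin m → ℝ} (hx : x ∈ independentCone R) :
    (saturate (‖x‖⁻¹ • x), auxValue (‖x‖⁻¹ • x)) ∈ chainSolutions R := by
  obtain ⟨j, hj⟩ := exists_normalized_eq_one hx
  refine ⟨⟨fun i => ⟨unitClamp_nonneg _, unitClamp_le_one _⟩,
    fun k => ⟨unitClamp_nonneg _, unitClamp_le_one _⟩⟩, fun a b hab => ?_, auxValue_zero _,
    auxValue_eq_zero (Fin.castSucc_lt_last j) hj, auxValue_step _⟩
  exact (hx.2.2 a b hab).imp (fun h => saturate_eq_zero (by simp [h]))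
    fun h => saturate_eq_zero (by simp [h])

/-- The continuous map from the cone to the solution space. -/
noncomputable def coneSection (R : Fin m → Fin m → Prop) :
    C(independentCone R, chainSolutions R) where
  toFun x := ⟨_, section_mem x.2⟩
  continuous_toFun := by
    have h : Continuous fun x : independentCone R => ‖(x : Fin m → ℝ)‖⁻¹ • (x : Fin m → ℝ) :=
      (Continuous.inv₀ (by fun_prop) fun x => (norm_pos_of_mem x.2).ne').smul (by fun_prop)
    exact ((continuous_saturate.comp h).prodMk (continuous_auxValue.comp h)).subtype_mk _

/-- Forgetting the auxiliary variables. -/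
def coneProjection (R : Fin m → Fin m → Prop) : C(chainSolutions R, independentCone R) where
  toFun q := ⟨q.1.1, fun i => (q.2.1.1 i).1, (exists_eq_one q.2).imp fun i hi => by simp [hi],
    q.2.2.1⟩
  continuous_toFun := by fun_prop

/-- Maps into the cone are homotopic when the support of one is contained in that of the other. -/
lemma homotopic_of_support_subset {X : Type*} [TopologicalSpace X] (f g : C(X, independentCone R))
    (h : ∀ x i, 0 < (f x : Fin m → ℝ) i → 0 < (g x : Fin m → ℝ) i) : f.Homotopic g := by
  refine homotopic_of_segment f g fun t ht0 ht1 x => ?_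
  obtain ⟨hf0, ⟨i, hi⟩, hf⟩ := (f x).2
  obtain ⟨hg0, -, hg⟩ := (g x).2
  have hz : ∀ j, (g x : Fin m → ℝ) j = 0 → (f x : Fin m → ℝ) j = 0 := fun j hj =>
    le_antisymm (not_lt.1 fun hlt => by simpa [hj] using h x j hlt) (hf0 j)
  refine ⟨fun j => ?_, ⟨i, ?_⟩, fun a b hab => ?_⟩
  · exact add_nonneg (mul_nonneg (by linarith) (hf0 j)) (mul_nonneg ht0 (hg0 j))
  · rcases ht0.eq_or_lt with rfl | ht
    · simpa using hi
    · exact add_pos_of_nonneg_of_pos (mul_nonneg (by linarith) hi.le) (mul_pos ht (h x i hi))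
  · exact (hg a b hab).imp (fun h => by simp [h, hz _ h]) fun h => by simp [h, hz _ h]

lemma saturate_mem {q} (hq : q ∈ chainSolutions R) : (saturate q.1, q.2) ∈ chainSolutions R := by
  obtain ⟨⟨-, hy⟩, hR, h0, hl, hs⟩ := hq
  exact ⟨⟨fun i => ⟨unitClamp_nonneg _, unitClamp_le_one _⟩, hy⟩,
    fun a b hab => (hR a b hab).imp saturate_eq_zero saturate_eq_zero, h0, hl,
    fun k => (hs k).imp_right (Or.imp_left saturate_eq_one)⟩

/-- Saturating the first coordinates of a solution. -/
noncomputable def saturateSolution (R : Fin m → Fin m → Prop) :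
    C(chainSolutions R, chainSolutions R) where
  toFun q := ⟨_, saturate_mem q.2⟩
  continuous_toFun := Continuous.subtype_mk
    ((continuous_saturate.comp (by fun_prop)).prodMk (by fun_prop)) _

lemma saturateSolution_homotopic_id :
    (saturateSolution R).Homotopic (ContinuousMap.id _) := by
  refine homotopic_of_segment _ _ fun t ht0 ht1 q => ?_
  obtain ⟨⟨x, y⟩, ⟨⟨hx, hy⟩, hR, h0, hl, hs⟩⟩ := q
  have hconv : (1 - t) • y + t • y = y := by rw [← add_smul]; simp
  change ((1 - t) • saturate x + t • x, (1 - t) • y + t • y) ∈ chainSolutions R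
  rw [hconv]
  refine ⟨⟨fun i => ?_, hy⟩, fun a b hab => (hR a b hab).imp ?_ ?_, h0, hl,
    fun k => (hs k).imp_right (Or.imp_left ?_)⟩
  · have h1 := unitClamp_nonneg ((m + 1) * x i)
    have h2 := unitClamp_le_one ((m + 1) * x i)
    obtain ⟨h3, h4⟩ := hx i
    simp only [Pi.add_apply, Pi.smul_apply, smul_eq_mul, saturate]
    constructor <;> nlinarith
  · intro h; change x a = 0 at h; simp [h, saturate_eq_zero h]
  · intro h; change x b = 0 at h; simp [h, saturate_eq_zero h]
  · intro h; change x k = 1 at h; simp [h, saturate_eq_one h]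

lemma saturateSolution_homotopic_section :
    (saturateSolution R).Homotopic ((coneSection R).comp (coneProjection R)) := by
  have hnorm : ∀ q : chainSolutions R, ‖q.1.1‖⁻¹ • q.1.1 = q.1.1 := fun q => by
    simp [norm_eq_one q.2]
  refine homotopic_of_continuous _ _
    (fun p => (saturate p.2.1.1, fun k => max (auxValue p.2.1.1 k) (p.2.1.2 k * dampFactor p.1 k)))
    ?_ (fun q => ?_) (fun q => ?_) fun t ht0 ht1 q => ?_
  · have h1 : Continuous fun p : ℝ × chainSolutions R => p.2.1.1 := by fun_prop
    have h2 : Continuous fun p : ℝ × chainSolutions R => p.2.1.2 := by fun_prop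
    refine (continuous_saturate.comp h1).prodMk (continuous_pi fun k => ?_)
    exact ((continuous_apply k).comp (continuous_auxValue.comp h1)).max
      (((continuous_apply k).comp h2).mul
        ((continuous_apply k).comp (continuous_dampFactor.comp continuous_fst)))
  · refine Prod.ext rfl (funext fun k => ?_)
    change max (auxValue q.1.1 k) (q.1.2 k * dampFactor 0 k) = q.1.2 k
    simpa [dampFactor_zero] using auxValue_le q.2 k
  · change _ = (saturate (‖q.1.1‖⁻¹ • q.1.1), auxValue (‖q.1.1‖⁻¹ • q.1.1))
    rw [hnorm]
    refine Prod.ext rfl (funext fun k => ?_)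
    change max (auxValue q.1.1 k) (q.1.2 k * dampFactor 1 k) = auxValue q.1.1 k
    rw [dampFactor_one, mul_zero]
    exact max_eq_left (unitClamp_nonneg _)
  · obtain ⟨j, hj⟩ := exists_eq_one q.2
    obtain ⟨⟨x, y⟩, ⟨⟨hx, hy⟩, hR, h0, hl, hs⟩⟩ := q
    have hd0 : ∀ k : Fin (m + 1), 0 ≤ dampFactor t k := fun k => unitClamp_nonneg _
    have hd1 : ∀ k : Fin (m + 1), dampFactor t k ≤ 1 := fun k => unitClamp_le_one _
    have hyd : ∀ k, y k * dampFactor t k ≤ 1 := fun k =>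
      mul_le_one₀ (hy k).2 (hd0 k) (hd1 k)
    have ha1 : ∀ k, auxValue x k ≤ 1 := fun k => unitClamp_le_one _
    refine ⟨⟨fun i => ⟨unitClamp_nonneg _, unitClamp_le_one _⟩,
      fun k => ⟨le_max_of_le_left (unitClamp_nonneg _), max_le (ha1 k) (hyd k)⟩⟩,
      fun a b hab => (hR a b hab).imp saturate_eq_zero saturate_eq_zero, ?_, ?_, fun k => ?_⟩
    · simpa [auxValue_zero] using hyd 0
    · change y (Fin.last m) = 0 at hl
      simp [auxValue_eq_zero (Fin.castSucc_lt_last j) hj, hl]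
    · change ∀ k : Fin m, y k.castSucc = 0 ∨ x k = 1 ∨ y k.succ = 1 at hs
      change max (auxValue x _) (y _ * _) = 0 ∨ saturate x k = 1 ∨
        max (auxValue x _) (y _ * _) = 1
      rcases auxValue_step x k with ha | ha | ha
      · rcases hs k with hk | hk | hk
        · exact .inl (by simp [ha, hk])
        · exact .inr (.inl (saturate_eq_one hk))
        · rcases dampFactor_step t k with hd | hd
          · exact .inl (by simp [ha, hd])
          · exact .inr (.inr (by simpa [hd, hk] using ha1 _))
      · exact .inr (.inl ha)
      · exact .inr (.inr (by simpa [ha] using hyd _))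

/-- The solution space is homotopy equivalent to the cone of independent vectors. -/
noncomputable def chainSolutionsEquiv (R : Fin m → Fin m → Prop) :
    ContinuousMap.HomotopyEquiv (chainSolutions R) (independentCone R) where
  toFun := coneProjection R
  invFun := coneSection R
  left_inv := saturateSolution_homotopic_section.symm.trans saturateSolution_homotopic_id
  right_inv := by
    refine (homotopic_of_support_subset _ _ fun x i hi => ?_).symm
    exact saturate_pos (mul_pos (inv_pos.2 (norm_pos_of_mem x.2)) hi)

end Projection

section Barycentric

variable {V : Type*} {m : ℕ} {e : Fin m → Finset V}

/-- Neither of the two sets contains the other. -/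
def Incomparable (e : Fin m → Finset V) (i j : Fin m) : Prop := ¬ e i ⊆ e j ∧ ¬ e j ⊆ e i

lemma exists_top {x : Fin m → ℝ} (hx : x ∈ independentCone (Incomparable e)) :
    ∃ i, ∀ j, x j ≠ 0 → e j ⊆ e i := by
  classical
  obtain ⟨h0, ⟨a, ha⟩, hR⟩ := hx
  obtain ⟨i, hi, hmax⟩ := exists_max_image (univ.filter fun j => x j ≠ 0) (fun j => (e j).card)
    ⟨a, by simpa using ha.ne'⟩
  refine ⟨i, fun j hj => ?_⟩
  by_contra hji
  by_cases hij : e i ⊆ e j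
  · exact hji (eq_of_subset_of_card_le hij (hmax j (by simpa using hj))).ge
  · exact (hR j i ⟨hji, hij⟩).elim hj (mem_filter.1 hi).2

variable [Fintype V]

/-- The standard geometric realization of the abstract complex generated by the sets `e i`. -/
def realization (e : Fin m → Finset V) : Set (V → ℝ) :=
  {l | (∀ v, 0 ≤ l v) ∧ ∑ v, l v = 1 ∧ ∃ i, ∀ v ∉ e i, l v = 0}

open Classical in
/-- A weight which is positive exactly when `e i` is a superlevel set of `l`. -/
noncomputable def levelWeight (e : Fin m → Finset V) (l : V → ℝ) (i : Fin m) : ℝ :=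
  ∏ v ∈ e i, l v * ∏ w ∈ (e i)ᶜ, max 0 (l v - l w)

open Classical in
/-- The point with barycentric coordinates proportional to `x` in the barycentric subdivision. -/
noncomputable def barySum (e : Fin m → Finset V) (x : Fin m → ℝ) (v : V) : ℝ :=
  (∑ i, x i)⁻¹ * ∑ i, if v ∈ e i then x i / (e i).card else 0

lemma continuous_levelWeight : Continuous (levelWeight e) := by
  unfold levelWeight
  fun_prop

lemma levelWeight_nonneg {l : V → ℝ} (hl : ∀ v, 0 ≤ l v) (i : Fin m) : 0 ≤ levelWeight e l i :=
  prod_nonneg fun v _ => mul_nonneg (hl v) (prod_nonneg fun _ _ => le_max_left _ _)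

lemma levelWeight_ne_zero_iff {l : V → ℝ} (hl : ∀ v, 0 ≤ l v) (i : Fin m) :
    levelWeight e l i ≠ 0 ↔ ∀ v ∈ e i, 0 < l v ∧ ∀ w ∉ e i, l w < l v := by
  classical
  have hmax : ∀ a : ℝ, max 0 a ≠ 0 ↔ 0 < a := fun a => by simp
  simp only [levelWeight, prod_ne_zero_iff, mul_ne_zero_iff, mem_compl, hmax, sub_pos,
    (hl _).lt_iff_ne']

lemma levelWeight_mem (hdown : ∀ i, ∀ s ⊆ e i, s.Nonempty → ∃ j, e j = s) {l : V → ℝ}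
    (hl : l ∈ realization e) :
    levelWeight e l ∈ independentCone (Incomparable e) := by
  classical
  obtain ⟨h0, h1, i, hi⟩ := hl
  refine ⟨levelWeight_nonneg h0, ?_, fun a b hab => ?_⟩
  · obtain ⟨j, hj⟩ := hdown i (univ.filter fun v => l v ≠ 0) (fun v hv => by
        by_contra h
        exact (mem_filter.1 hv).2 (hi v h)) (by
        by_contra h
        simp only [not_nonempty_iff_eq_empty, filter_eq_empty_iff, mem_univ, true_imp_iff,
          not_not] at h
        simp [h] at h1)
    refine ⟨j, (levelWeight_nonneg h0 j).lt_of_ne' ((levelWeight_ne_zero_iff h0 j).2 ?_)⟩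
    simp only [hj, mem_filter, mem_univ, true_and, not_not]
    exact fun v hv => ⟨(h0 v).lt_of_ne' hv, fun w hw => hw ▸ (h0 v).lt_of_ne' hv⟩
  · by_contra! h
    obtain ⟨v, hva, hvb⟩ := not_subset.1 hab.1
    obtain ⟨w, hwb, hwa⟩ := not_subset.1 hab.2
    exact lt_asymm (((levelWeight_ne_zero_iff h0 a).1 h.1 v hva).2 w hwa)
      (((levelWeight_ne_zero_iff h0 b).1 h.2 w hwb).2 v hvb)

lemma sum_pos_of_mem {R : Fin m → Fin m → Prop} {x : Fin m → ℝ} (hx : x ∈ independentCone R) :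
    0 < ∑ i, x i :=
  let ⟨i, hi⟩ := hx.2.1
  sum_pos' (fun j _ => hx.1 j) ⟨i, mem_univ i, hi⟩

lemma barySum_mem (hne : ∀ i, (e i).Nonempty) {x : Fin m → ℝ}
    (hx : x ∈ independentCone (Incomparable e)) : barySum e x ∈ realization e := by
  classical
  have hS := sum_pos_of_mem hx
  refine ⟨fun v => ?_, ?_, ?_⟩
  · refine mul_nonneg (inv_nonneg.2 hS.le) (sum_nonneg fun i _ => ?_)
    split_ifs
    exacts [div_nonneg (hx.1 i) (Nat.cast_nonneg _), le_rfl]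
  · have h : ∀ i, ∑ v, (if v ∈ e i then x i / (e i).card else 0) = x i := fun i => by
      have : ((e i).card : ℝ) ≠ 0 := by exact_mod_cast (hne i).card_pos.ne'
      simp only [sum_ite_mem, univ_inter, sum_const, nsmul_eq_mul]
      field_simp
    simp only [barySum, ← mul_sum]
    rw [sum_comm, sum_congr rfl fun i _ => h i, inv_mul_cancel₀ hS.ne']
  · obtain ⟨i, hi⟩ := exists_top hx
    refine ⟨i, fun v hv => ?_⟩
    refine mul_eq_zero_of_right _ (sum_eq_zero fun j _ => ?_)
    by_cases hj : x j = 0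
    · simp [hj]
    · exact if_neg fun h => hv (hi j hj h)

lemma levelWeight_barySum_pos (hne : ∀ i, (e i).Nonempty) {x : Fin m → ℝ}
    (hx : x ∈ independentCone (Incomparable e)) {i : Fin m} (hi : 0 < x i) :
    0 < levelWeight e (barySum e x) i := by
  classical
  have hS := inv_pos.2 (sum_pos_of_mem hx)
  have h0 := (barySum_mem hne hx).1
  refine (levelWeight_nonneg h0 i).lt_of_ne' ((levelWeight_ne_zero_iff h0 i).2 fun v hv => ?_)
  have hcard : (0 : ℝ) < (e i).card := by exact_mod_cast (hne i).card_pos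
  have hlt : ∀ w ∉ e i, barySum e x w < barySum e x v := fun w hw => by
    refine mul_lt_mul_of_pos_left (sum_lt_sum (fun j _ => ?_) ⟨i, mem_univ i, ?_⟩) hS
    · have hj := div_nonneg (hx.1 j) (Nat.cast_nonneg (α := ℝ) (e j).card)
      by_cases hwj : w ∈ e j
      · rw [if_pos hwj]
        by_cases hvj : v ∈ e j
        · rw [if_pos hvj]
        · rcases hx.2.2 i j ⟨fun h => hvj (h hv), fun h => hw (h hwj)⟩ with h | h
          · exact absurd h hi.ne'
          · simp [h]
      · rw [if_neg hwj]
        split_ifs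
        exacts [hj, le_rfl]
    · rw [if_neg hw, if_pos hv]
      positivity
  refine ⟨mul_pos hS (sum_pos' (fun j _ => ?_) ⟨i, mem_univ i, ?_⟩), hlt⟩
  · split_ifs
    exacts [div_nonneg (hx.1 j) (Nat.cast_nonneg _), le_rfl]
  · rw [if_pos hv]
    positivity

lemma barySum_levelWeight_eq_zero {l : V → ℝ} (hl : ∀ v, 0 ≤ l v) {v : V} (hv : l v = 0) :
    barySum e (levelWeight e l) v = 0 := by
  classical
  refine mul_eq_zero_of_right _ (sum_eq_zero fun i _ => ?_)
  by_cases hi : v ∈ e i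
  · have : levelWeight e l i = 0 := by
      by_contra h
      exact (((levelWeight_ne_zero_iff hl i).1 h v hi).1).ne' hv
    simp [this]
  · exact if_neg hi

/-- Barycentric subdivision: the cone of weights on flags of faces is homotopy equivalent to the
geometric realization. -/
noncomputable def independentConeEquiv (hdown : ∀ i, ∀ s ⊆ e i, s.Nonempty → ∃ j, e j = s)
    (hne : ∀ i, (e i).Nonempty) :
    ContinuousMap.HomotopyEquiv (independentCone (Incomparable e)) (realization e) where
  toFun :=
    { toFun := fun x => ⟨_, barySum_mem hne x.2⟩
      continuous_toFun := by
        classical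
        refine Continuous.subtype_mk (continuous_pi fun v => ?_) _
        refine (Continuous.inv₀ (by fun_prop) fun x => (sum_pos_of_mem x.2).ne').mul
          (continuous_finsetSum _ fun i _ => ?_)
        split_ifs
        exacts [((continuous_apply i).comp continuous_subtype_val).div_const _,
          continuous_const] }
  invFun :=
    { toFun := fun l => ⟨_, levelWeight_mem hdown l.2⟩
      continuous_toFun := (continuous_levelWeight.comp continuous_subtype_val).subtype_mk _ }
  left_inv := (homotopic_of_support_subset _ _ fun x _ hi =>
    levelWeight_barySum_pos hne x.2 hi).symm
  right_inv := by
    refine homotopic_of_segment _ _ fun t ht0 ht1 l => ?_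
    obtain ⟨h0, h1, i, hi⟩ := l.2
    obtain ⟨g0, g1, -⟩ := barySum_mem hne (levelWeight_mem hdown l.2)
    refine ⟨fun v => ?_, ?_, i, fun v hv => ?_⟩
    · exact add_nonneg (mul_nonneg (by linarith) (g0 v)) (mul_nonneg ht0 (h0 v))
    · change ∑ v, ((1 - t) * barySum e (levelWeight e l) v + t * (l : V → ℝ) v) = 1
      rw [sum_add_distrib, ← mul_sum, ← mul_sum, g1, h1]
      ring
    · change (1 - t) * barySum e (levelWeight e l) v + t * (l : V → ℝ) v = 0
      rw [barySum_levelWeight_eq_zero h0 (hi v hv), hi v hv]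
      ring

lemma isCompact_realization (e : Fin m → Finset V) : IsCompact (realization e) := by
  refine (isCompact_univ_pi fun _ : V => isCompact_Icc (a := (0 : ℝ)) (b := 1)).of_isClosed_subset
    ?_ fun l hl v _ => ⟨hl.1 v, hl.2.1 ▸ single_le_sum (fun w _ => hl.1 w) (mem_univ v)⟩
  have : realization e = {l : V → ℝ | ∀ v, 0 ≤ l v} ∩ ({l | ∑ v, l v = 1} ∩
      ⋃ i, {l | ∀ v ∉ e i, l v = 0}) := by
    ext l
    simp [realization]
  rw [this]
  refine IsClosed.inter ?_ (IsClosed.inter ?_ (isClosed_iUnion_of_finite fun i => ?_))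
  · simp only [Set.ofPred_forall]
    exact isClosed_iInter fun v => isClosed_le continuous_const (continuous_apply v)
  · exact isClosed_eq (by fun_prop) continuous_const
  · simp only [Set.ofPred_forall]
    exact isClosed_iInter fun v => isClosed_iInter fun _ =>
      isClosed_eq (continuous_apply v) continuous_const

end Barycentric

section Geometric

variable {n : ℕ} (K : Geometry.SimplicialComplex ℝ (Fin n → ℝ))

/-- Barycentric coordinates with respect to a face are unique. -/
lemma weights_unique {s : Finset (Fin n → ℝ)} (hs : s ∈ K.faces) {a b : (Fin n → ℝ) → ℝ}
    (hsum : ∑ v ∈ s, a v = ∑ v ∈ s, b v) (h : ∑ v ∈ s, a v • v = ∑ v ∈ s, b v • v) :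
    ∀ v ∈ s, a v = b v := by
  intro v hv
  have := (affineIndependent_iff.1 (K.indep hs)) univ (fun v => a v - b v)
    (by rw [sum_coe_sort s fun v => a v - b v, sum_sub_distrib, hsum, sub_self])
    (by rw [sum_coe_sort s fun v => (a v - b v) • v]
        simp only [sub_smul, sum_sub_distrib, h, sub_self]) ⟨v, hv⟩ (mem_univ _)
  exact sub_eq_zero.1 this

/-- A point of a simplicial complex determines its barycentric coordinates. -/
lemma weights_unique_of_faces {s t : Finset (Fin n → ℝ)} (hs : s ∈ K.faces) (ht : t ∈ K.faces)
    {a b : (Fin n → ℝ) → ℝ} (ha : ∀ v ∈ s, 0 ≤ a v) (hb : ∀ v ∈ t, 0 ≤ b v)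
    (has : ∀ v ∉ s, a v = 0) (hbt : ∀ v ∉ t, b v = 0)
    (ha1 : ∑ v ∈ s, a v = 1) (hb1 : ∑ v ∈ t, b v = 1)
    (h : ∑ v ∈ s, a v • v = ∑ v ∈ t, b v • v) : a = b := by
  classical
  have hmem : ∑ v ∈ s, a v • v ∈ convexHull ℝ (↑(s ∩ t) : Set (Fin n → ℝ)) := by
    rw [coe_inter]
    refine K.inter_subset_convexHull hs ht ⟨mem_convexHull'.2 ⟨a, ha, ha1, rfl⟩, ?_⟩
    rw [h]
    exact mem_convexHull'.2 ⟨b, hb, hb1, rfl⟩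
  obtain ⟨c, -, hc1, hc⟩ := mem_convexHull'.1 hmem
  have key : ∀ u ∈ K.faces, s ∩ t ⊆ u → ∀ d : (Fin n → ℝ) → ℝ, (∀ v ∉ u, d v = 0) →
      ∑ v ∈ u, d v = 1 → ∑ v ∈ u, d v • v = ∑ v ∈ s, a v • v →
      ∀ v, d v = if v ∈ s ∩ t then c v else 0 := by
    intro u hu hsub d hd hd1 hdv v
    by_cases hv : v ∈ u
    · refine weights_unique K hu (b := fun v => if v ∈ s ∩ t then c v else 0) ?_ ?_ v hv
      · rw [hd1, sum_ite_mem, inter_eq_right.2 hsub, hc1]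
      · simp only [ite_smul, zero_smul]
        rw [hdv, sum_ite_mem, inter_eq_right.2 hsub, hc]
    · rw [hd v hv, if_neg fun h => hv (hsub h)]
  funext v
  rw [key s hs inter_subset_left a has ha1 rfl v, key t ht inter_subset_right b hbt hb1 h.symm v]

/-- The space of a finite geometric simplicial complex is the realization of its face sets. -/
theorem exists_homeomorph_realization (hK : K.faces.Finite) :
    ∃ (W : Finset (Fin n → ℝ)) (m : ℕ) (e : Fin m → Finset W),
      (∀ i, ∀ s ⊆ e i, s.Nonempty → ∃ j, e j = s) ∧ (∀ i, (e i).Nonempty) ∧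
      Nonempty (realization e ≃ₜ K.space) := by
  classical
  set F := hK.toFinset
  set W : Finset (Fin n → ℝ) := F.biUnion id
  set f : Fin F.card → Finset (Fin n → ℝ) := fun i => F.equivFin.symm i
  have hf : ∀ i, f i ∈ K.faces := fun i => hK.mem_toFinset.1 (F.equivFin.symm i).2
  have hf' : ∀ s ∈ K.faces, ∃ i, f i = s := fun s hs =>
    ⟨F.equivFin ⟨s, hK.mem_toFinset.2 hs⟩, by simp [f]⟩
  have hW : ∀ i, f i ⊆ W := fun i => subset_biUnion_of_mem id (F.equivFin.symm i).2
  set e : Fin F.card → Finset W := fun i => (f i).subtype (· ∈ W)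
  have hmap : ∀ i, (e i).map (Function.Embedding.subtype _) = f i := fun i => by
    rw [subtype_map, filter_eq_self]
    exact fun v hv => hW i hv
  set ext : (W → ℝ) → (Fin n → ℝ) → ℝ := fun l v => if h : v ∈ W then l ⟨v, h⟩ else 0
  have hext : ∀ l (v : W), ext l v = l v := fun l v => by simp [ext]
  have hzero : ∀ l i, (∀ v ∉ e i, l v = 0) → ∀ v ∉ f i, ext l v = 0 := by
    intro l i hl v hv
    by_cases h : v ∈ W
    · exact (hext l ⟨v, h⟩).trans (hl _ (by simpa [e] using hv))
    · simp [ext, h]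
  have hsum : ∀ {M : Type} [AddCommMonoid M] (i) (g : (Fin n → ℝ) → M),
      (∀ v ∉ f i, g v = 0) → ∑ v : W, g v = ∑ v ∈ f i, g v := by
    intro M _ i g hg
    rw [sum_coe_sort W g]
    exact (sum_subset (hW i) fun v _ hv => hg v hv).symm
  have hsum1 : ∀ l i, (∀ v ∉ e i, l v = 0) → ∑ v, l v = ∑ v ∈ f i, ext l v := by
    intro l i hl
    rw [← hsum i (ext l) (hzero l i hl)]
    simp [hext]
  have hsum2 : ∀ l i, (∀ v ∉ e i, l v = 0) →
      ∑ v : W, l v • (v : Fin n → ℝ) = ∑ v ∈ f i, ext l v • v := by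
    intro l i hl
    rw [← hsum i (fun v => ext l v • v) fun v hv => by simp [hzero l i hl v hv]]
    simp [hext]
  have hnonneg : ∀ l : W → ℝ, (∀ v, 0 ≤ l v) → ∀ v, 0 ≤ ext l v := by
    intro l hl v
    simp only [ext]
    split_ifs
    exacts [hl _, le_rfl]
  have hmem : ∀ l ∈ realization e, ∑ v : W, l v • (v : Fin n → ℝ) ∈ K.space := by
    rintro l ⟨h0, h1, i, hi⟩
    refine K.convexHull_subset_space (hf i) (mem_convexHull'.2
      ⟨ext l, fun v _ => hnonneg l h0 v, ?_, ?_⟩)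
    · rw [← hsum1 l i hi, h1]
    · rw [← hsum2 l i hi]
  let φ : realization e → K.space := fun l => ⟨_, hmem l l.2⟩
  have hφ : Function.Bijective φ := by
    constructor
    · rintro ⟨l, h0, h1, i, hi⟩ ⟨l', h0', h1', j, hj⟩ h
      have h : ∑ v : W, l v • (v : Fin n → ℝ) = ∑ v : W, l' v • (v : Fin n → ℝ) :=
        congrArg Subtype.val h
      have := weights_unique_of_faces K (hf i) (hf j) (fun v _ => hnonneg l h0 v)
        (fun v _ => hnonneg l' h0' v) (hzero l i hi) (hzero l' j hj) (by rw [← hsum1 l i hi, h1])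
        (by rw [← hsum1 l' j hj, h1']) (by rw [← hsum2 l i hi, ← hsum2 l' j hj, h])
      refine Subtype.ext (funext fun v => ?_)
      exact (hext l v).symm.trans ((congrFun this v).trans (hext l' v))
    · rintro ⟨p, hp⟩
      obtain ⟨s, hs, hps⟩ := K.mem_space_iff.1 hp
      obtain ⟨i, rfl⟩ := hf' s hs
      obtain ⟨w, hw0, hw1, hwp⟩ := mem_convexHull'.1 hps
      let l : W → ℝ := fun v => if v ∈ e i then w v else 0
      have hl : ∀ v ∉ e i, l v = 0 := fun v hv => if_neg hv
      have hlw : ∀ v ∈ f i, ext l v = w v := fun v hv => by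
        refine (hext l ⟨v, hW i hv⟩).trans (if_pos ?_)
        simpa [e] using hv
      refine ⟨⟨l, fun v => ?_, ?_, i, hl⟩, Subtype.ext ?_⟩
      · simp only [l]
        split_ifs with h
        · exact hw0 v (by simpa [e] using h)
        · exact le_rfl
      · rw [hsum1 l i hl, sum_congr rfl hlw, hw1]
      · change ∑ v : W, l v • (v : Fin n → ℝ) = p
        rw [hsum2 l i hl, sum_congr rfl fun v hv => by rw [hlw v hv], hwp]
  have : CompactSpace (realization e) := isCompact_iff_compactSpace.1 (isCompact_realization e)
  have hcont : Continuous (Equiv.ofBijective φ hφ) := Continuous.subtype_mk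
    (continuous_finsetSum _ fun v _ =>
      ((continuous_apply v).comp continuous_subtype_val).smul continuous_const) _
  refine ⟨W, _, e, fun i s hs hne => ?_, fun i => ?_, ⟨hcont.homeoOfEquivCompactToT2⟩⟩
  · obtain ⟨j, hj⟩ := hf' _ (K.down_closed (hf i)
      (hmap i ▸ map_subset_map.2 hs : s.map (Function.Embedding.subtype _) ⊆ f i)
      (by simpa using hne))
    exact ⟨j, map_injective _ ((hmap j).trans hj)⟩
  · rw [← map_nonempty (f := Function.Embedding.subtype _), hmap]
    exact K.nonempty_of_mem_faces (hf i)

end Geometric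

end CubicalSAT

/-- (3,2,2)-SAT is homotopy-universal for finite simplicial complexes. -/
theorem sat322_homotopy_universal
    (n : ℕ) (K : Geometry.SimplicialComplex ℝ (Fin n → ℝ)) (hK : K.faces.Finite) :
    ∃ (d : ℕ) (Φ : Finset (Finset (Fin d × Bool))),
      (∀ C ∈ Φ, C.card ≤ 3 ∧ (C.filter fun l => l.2 = true).card ≤ 2 ∧
        (C.filter fun l => l.2 = false).card ≤ 2) ∧
      Nonempty (ContinuousMap.HomotopyEquiv
        (inducedCubicalComplex (cnfDisc Φ)) K.space) := by
  obtain ⟨W, m, e, hdown, hne, ⟨φ⟩⟩ := CubicalSAT.exists_homeomorph_realization K hK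
  refine ⟨_, CubicalSAT.chainFormula (CubicalSAT.Incomparable e),
    fun C hC => CubicalSAT.card_of_mem_chainFormula _ hC, ⟨?_⟩⟩
  exact (CubicalSAT.chainSolutionsHomeomorph _).symm.toHomotopyEquiv.trans
    ((CubicalSAT.chainSolutionsEquiv _).trans
      ((CubicalSAT.independentConeEquiv hdown hne).trans φ.toHomotopyEquiv))
end

section
/- Let Φ be the CNF formula over Fin 3 consisting of the two clauses {(0,true),(1,true),(2,true)} (i.e. x₁ ∨ x₂ ∨ x₃) and {(0,false),(1,false),(2,false)} (i.e. ¬x₁ ∨ ¬x₂ ∨ ¬x₃). Then the induced cubical complex N(disc(Φ)) ⊆ (Fin 3 → ℝ) is homeomorphic to the unit circle Metric.sphere (0 : EuclideanSpace ℝ (Fin 2)) 1. -/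
/-- The formula `(x₁ ∨ x₂ ∨ x₃) ∧ (¬x₁ ∨ ¬x₂ ∨ ¬x₃)`. -/
def circleFormula : Finset (Finset (Fin 3 × Bool)) :=
  { {((0 : Fin 3), true), ((1 : Fin 3), true), ((2 : Fin 3), true)},
    {((0 : Fin 3), false), ((1 : Fin 3), false), ((2 : Fin 3), false)} }

/-- The least coordinate of a vector in `ℝ³`. -/
noncomputable def minCoord (w : Fin 3 → ℝ) : ℝ := min (w 0) (min (w 1) (w 2))

/-- The greatest coordinate of a vector in `ℝ³`. -/
noncomputable def maxCoord (w : Fin 3 → ℝ) : ℝ := max (w 0) (max (w 1) (w 2))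

/-- Rescale the coordinates of a vector so that they range from `0` to `1`. -/
noncomputable def rescale (w : Fin 3 → ℝ) (i : Fin 3) : ℝ :=
  (w i - minCoord w) / (maxCoord w - minCoord w)

/-- The linear map `ℝ³ → ℝ²` of consecutive differences. -/
noncomputable def coordDiff (p : Fin 3 → ℝ) : EuclideanSpace ℝ (Fin 2) :=
  !₂[p 0 - p 1, p 1 - p 2]

/-- The section of `coordDiff` whose last coordinate vanishes. -/
noncomputable def liftDiff (u : EuclideanSpace ℝ (Fin 2)) : Fin 3 → ℝ :=
  ![u 0 + u 1, u 1, 0]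

theorem continuous_coordDiff : Continuous coordDiff := by
  unfold coordDiff
  fun_prop

theorem continuous_liftDiff : Continuous liftDiff := by
  refine continuous_pi fun i => ?_
  fin_cases i <;> simp [liftDiff] <;> fun_prop

theorem minCoord_affine {c : ℝ} (hc : 0 < c) (d : ℝ) (w : Fin 3 → ℝ) :
    minCoord (fun i => c * w i + d) = c * minCoord w + d := by
  simp only [minCoord, mul_min_of_nonneg _ _ hc.le, min_add_add_right]

theorem maxCoord_affine {c : ℝ} (hc : 0 < c) (d : ℝ) (w : Fin 3 → ℝ) :
    maxCoord (fun i => c * w i + d) = c * maxCoord w + d := by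
  simp only [maxCoord, mul_max_of_nonneg _ _ hc.le, max_add_add_right]

theorem rescale_affine {c : ℝ} (hc : 0 < c) (d : ℝ) (w : Fin 3 → ℝ) :
    rescale (fun i => c * w i + d) = rescale w := by
  funext i
  simp only [rescale, minCoord_affine hc, maxCoord_affine hc]
  rw [add_sub_add_right_eq_sub, add_sub_add_right_eq_sub, ← mul_sub, ← mul_sub,
    mul_div_mul_left _ _ hc.ne']

theorem minCoord_le (w : Fin 3 → ℝ) (i : Fin 3) : minCoord w ≤ w i := by
  fin_cases i <;> simp [minCoord]

theorem le_maxCoord (w : Fin 3 → ℝ) (i : Fin 3) : w i ≤ maxCoord w := by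
  fin_cases i <;> simp [maxCoord]

theorem exists_eq_minCoord (w : Fin 3 → ℝ) : ∃ i, w i = minCoord w := by
  simp only [Fin.exists_fin_succ, minCoord]
  grind

theorem exists_eq_maxCoord (w : Fin 3 → ℝ) : ∃ i, w i = maxCoord w := by
  simp only [Fin.exists_fin_succ, maxCoord]
  grind

theorem mem_cnfDisc_circleFormula (v : Fin 3 → Bool) :
    v ∈ cnfDisc circleFormula ↔ (∃ i, v i = true) ∧ ∃ i, v i = false := by
  simp [cnfDisc, circleFormula, Fin.exists_fin_succ]

theorem mem_inducedCubicalComplex_circleFormula (p : Fin 3 → ℝ) :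
    p ∈ inducedCubicalComplex (cnfDisc circleFormula) ↔ minCoord p = 0 ∧ maxCoord p = 1 := by
  simp only [inducedCubicalComplex, Set.mem_ofPred_eq, mem_cnfDisc_circleFormula]
  obtain ⟨i, hi⟩ := exists_eq_minCoord p
  obtain ⟨j, hj⟩ := exists_eq_maxCoord p
  constructor
  · rintro ⟨hp, hv⟩
    have h_one : ∃ k, p k = 1 := by
      by_contra! h
      simpa using (hv (fun _ => false) fun k => by simp [h k]).1
    have h_zero : ∃ k, p k = 0 := by
      by_contra! h
      simpa using (hv (fun _ => true) fun k => by simp [h k]).2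
    obtain ⟨k, hk⟩ := h_one
    obtain ⟨l, hl⟩ := h_zero
    exact ⟨le_antisymm (hl ▸ minCoord_le p l) (hi ▸ (hp i).1),
      le_antisymm (hj ▸ (hp j).2) (hk ▸ le_maxCoord p k)⟩
  · rintro ⟨h0, h1⟩
    exact ⟨fun k => ⟨h0 ▸ minCoord_le p k, h1 ▸ le_maxCoord p k⟩,
      fun v hv => ⟨⟨j, (hv j).2 (hj.trans h1)⟩, ⟨i, (hv i).1 (hi.trans h0)⟩⟩⟩

theorem rescale_eq_affine (w : Fin 3 → ℝ) :
    rescale w = fun i => (maxCoord w - minCoord w)⁻¹ * w i +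
      -((maxCoord w - minCoord w)⁻¹ * minCoord w) := by
  funext i
  rw [rescale, div_eq_inv_mul, mul_sub, sub_eq_add_neg]

theorem rescale_mem {w : Fin 3 → ℝ} (hw : minCoord w < maxCoord w) :
    rescale w ∈ inducedCubicalComplex (cnfDisc circleFormula) := by
  have h : 0 < maxCoord w - minCoord w := sub_pos.2 hw
  rw [mem_inducedCubicalComplex_circleFormula, rescale_eq_affine,
    minCoord_affine (inv_pos.2 h), maxCoord_affine (inv_pos.2 h)]
  refine ⟨by ring, ?_⟩
  field_simp
  ring

theorem rescale_of_mem {p : Fin 3 → ℝ}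
    (hp : p ∈ inducedCubicalComplex (cnfDisc circleFormula)) : rescale p = p := by
  rw [mem_inducedCubicalComplex_circleFormula] at hp
  funext i
  simp [rescale, hp.1, hp.2]

theorem coordDiff_affine (c d : ℝ) (w : Fin 3 → ℝ) :
    coordDiff (fun i => c * w i + d) = c • coordDiff w := by
  ext i
  fin_cases i <;> simp [coordDiff] <;> ring

theorem coordDiff_liftDiff (u : EuclideanSpace ℝ (Fin 2)) : coordDiff (liftDiff u) = u := by
  ext i
  fin_cases i <;> simp [coordDiff, liftDiff]

theorem liftDiff_smul_coordDiff (c : ℝ) (p : Fin 3 → ℝ) :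
    liftDiff (c • coordDiff p) = fun i => c * p i + -(c * p 2) := by
  funext i
  fin_cases i <;> simp [coordDiff, liftDiff] <;> ring

theorem minCoord_lt_maxCoord {w : Fin 3 → ℝ} (hw : coordDiff w ≠ 0) :
    minCoord w < maxCoord w := by
  contrapose! hw
  have h (i : Fin 3) : w i = minCoord w :=
    le_antisymm ((le_maxCoord w i).trans hw) (minCoord_le w i)
  ext i
  fin_cases i <;> simp [coordDiff, h]

theorem coordDiff_ne_zero {p : Fin 3 → ℝ}
    (hp : p ∈ inducedCubicalComplex (cnfDisc circleFormula)) : coordDiff p ≠ 0 := by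
  intro h
  rw [mem_inducedCubicalComplex_circleFormula] at hp
  have h01 : p 0 - p 1 = 0 := by simpa [coordDiff] using congrArg (fun u => u 0) h
  have h12 : p 1 - p 2 = 0 := by simpa [coordDiff] using congrArg (fun u => u 1) h
  rw [minCoord, maxCoord, sub_eq_zero.1 h01, sub_eq_zero.1 h12] at hp
  simp only [min_self, max_self] at hp
  exact zero_ne_one (hp.1.symm.trans hp.2)

theorem minCoord_lt_maxCoord_liftDiff
    (u : Metric.sphere (0 : EuclideanSpace ℝ (Fin 2)) 1) :
    minCoord (liftDiff u) < maxCoord (liftDiff u) :=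
  minCoord_lt_maxCoord <| by
    rw [coordDiff_liftDiff]
    exact ne_zero_of_mem_unit_sphere u

/-- Radial projection from the induced cubical complex of `circleFormula`, a hexagon,
onto the unit circle. -/
noncomputable def circleFormulaHomeomorph :
    inducedCubicalComplex (cnfDisc circleFormula) ≃ₜ
      Metric.sphere (0 : EuclideanSpace ℝ (Fin 2)) 1 where
  toFun p := ⟨‖coordDiff p‖⁻¹ • coordDiff p, by
    simp [norm_smul, norm_ne_zero_iff.2 (coordDiff_ne_zero p.2)]⟩
  invFun u := ⟨rescale (liftDiff u), rescale_mem (minCoord_lt_maxCoord_liftDiff u)⟩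
  left_inv p := by
    have h : 0 < ‖coordDiff p‖⁻¹ := inv_pos.2 (norm_pos_iff.2 (coordDiff_ne_zero p.2))
    ext1
    simp only [liftDiff_smul_coordDiff, rescale_affine h, rescale_of_mem p.2]
  right_inv u := by
    have h : 0 < maxCoord (liftDiff u) - minCoord (liftDiff u) :=
      sub_pos.2 (minCoord_lt_maxCoord_liftDiff u)
    ext1
    simp only [rescale_eq_affine, coordDiff_affine, coordDiff_liftDiff, norm_smul,
      norm_eq_of_mem_sphere, mul_one, smul_smul]
    rw [Real.norm_of_nonneg (inv_pos.2 h).le, inv_mul_cancel₀ (inv_pos.2 h).ne', one_smul]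
  continuous_toFun := by
    have h : Continuous fun p : inducedCubicalComplex (cnfDisc circleFormula) =>
        coordDiff p := continuous_coordDiff.comp continuous_subtype_val
    exact ((h.norm.inv₀ fun p => norm_ne_zero_iff.2 (coordDiff_ne_zero p.2)).smul h).subtype_mk _
  continuous_invFun := by
    have h : Continuous fun u : Metric.sphere (0 : EuclideanSpace ℝ (Fin 2)) 1 =>
        liftDiff u := continuous_liftDiff.comp continuous_subtype_val
    have h_min : Continuous minCoord := by unfold minCoord; fun_prop
    have h_max : Continuous maxCoord := by unfold maxCoord; fun_prop
    refine Continuous.subtype_mk (continuous_pi fun i => ?_) _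
    exact (((continuous_apply i).comp h).sub (h_min.comp h)).div
      ((h_max.comp h).sub (h_min.comp h))
      fun u => (sub_pos.2 (minCoord_lt_maxCoord_liftDiff u)).ne'



/-- The induced cubical complex of the solution space of
`(x₁ ∨ x₂ ∨ x₃) ∧ (¬x₁ ∨ ¬x₂ ∨ ¬x₃)` is homeomorphic to the unit circle. -/
theorem circleFormula_homeomorphic_circle :
    Nonempty ((inducedCubicalComplex (cnfDisc circleFormula)) ≃ₜ
      (Metric.sphere (0 : EuclideanSpace ℝ (Fin 2)) 1)) := by
  exact ⟨circleFormulaHomeomorph⟩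
end
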